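/- Define C_H^ε = [C₁·∑_{m=0}^∞ (q_m^{s₀}·f(a_ε coth ξ_m^{s₀}) − q_m^{ξ₁}·f(−a_ε coth ξ_m^{ξ₁})) − C₂·∑_{m=0}^∞ (q_m^{ξ₂}·f(a_ε coth ξ_m^{ξ₂}) − q_m^{s₀}·f(−a_ε coth ξ_m^{s₀}))]/(C₁ − C₂), and C_H = 4πμ₁·∑_{m=0}^∞ [(r̃/(m+1))·f(r̃/(m+1)) − (r̃/(m+r̃₂))·f(−r̃/(m+r̃₂))] + 4πμ₂·∑_{m=0}^∞ [(r̃/(m+r̃₁))·f(r̃/(m+r̃₁)) − (r̃/(m+1))·f(−r̃/(m+1))]. Then there exist C > 0 and ε₀ > 0 such that for all ε ∈ (0, ε₀) one has C₁ ≠ C₂ and |C_H^ε − C_H| ≤ C·ε·|ln ε|. -/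

import Mathlib

open Real

noncomputable section

/-- The distance parameter `a_ε`. -/
def aEps (r₁ r₂ ε : ℝ) : ℝ :=
  Real.sqrt ε * Real.sqrt ((2*r₁+ε)*(2*r₂+ε)*(2*r₁+2*r₂+ε)) / (2*(r₁+r₂+ε))

def xi (r : ℝ) (r₁ r₂ ε : ℝ) : ℝ := Real.arsinh (aEps r₁ r₂ ε / r)

def sZero (r₁ r₂ ε : ℝ) : ℝ := xi r₁ r₁ r₂ ε + xi r₂ r₁ r₂ ε

/-- The hyperbolic cotangent. -/
def coth (x : ℝ) : ℝ := Real.cosh x / Real.sinh x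

/-- `ξ_m^c = m·s₀ + c`. -/
def xiM (r₁ r₂ ε c : ℝ) (m : ℕ) : ℝ := m * sZero r₁ r₂ ε + c

/-- `q_m^c = 4π a_ε / sinh(ξ_m^c)`. -/
def qM (r₁ r₂ ε c : ℝ) (m : ℕ) : ℝ :=
  4 * Real.pi * aEps r₁ r₂ ε / Real.sinh (xiM r₁ r₂ ε c m)

/-- `U(c) = ∑_{n≥0} e^{(2n+1)c}/(e^{(2n+1)s₀} − 1)`. -/
def U (s₀ c : ℝ) : ℝ := ∑' n : ℕ, Real.exp ((2*n+1) * c) / (Real.exp ((2*n+1) * s₀) - 1)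

/-- `C_j` for `j = 1, 2` (with sign `(−1)^j`). -/
def Cconst (r₁ r₂ ε : ℝ) (j : ℕ) : ℝ :=
  ((-1) ^ j / (8 * Real.pi * aEps r₁ r₂ ε)) *
    ((U (sZero r₁ r₂ ε) (xi (if j = 1 then r₁ else r₂) r₁ r₂ ε) - U (sZero r₁ r₂ ε) 0) /
      (U (sZero r₁ r₂ ε) (xi r₁ r₁ r₂ ε) * U (sZero r₁ r₂ ε) (xi r₂ r₁ r₂ ε) -
        (U (sZero r₁ r₂ ε) 0) ^ 2))

/-- The digamma value `ψ₀(z) = −γ + ∑_{k≥0} (z−1)/((k+1)(k+z))`. -/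
def digammaVal (z : ℝ) : ℝ :=
  -Real.eulerMascheroniConstant + ∑' k : ℕ, (z - 1) / ((k + 1) * (k + z))

def rTilde (r₁ r₂ : ℝ) : ℝ := r₁ * r₂ / (r₁ + r₂)

/-- `μ_j` for `j = 1, 2`. -/
def muConst (r₁ r₂ : ℝ) (j : ℕ) : ℝ :=
  (digammaVal ((if j = 1 then r₁ else r₂) / (r₁ + r₂)) + Real.eulerMascheroniConstant) /
    (digammaVal (r₁ / (r₁ + r₂)) + digammaVal (r₂ / (r₁ + r₂)) +
      2 * Real.eulerMascheroniConstant)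

/-- The concentration factor `C_H^ε`. -/
def CHeps (f : ℝ → ℝ) (r₁ r₂ ε : ℝ) : ℝ :=
  (Cconst r₁ r₂ ε 1 *
      (∑' m : ℕ, (qM r₁ r₂ ε (sZero r₁ r₂ ε) m *
          f (aEps r₁ r₂ ε * coth (xiM r₁ r₂ ε (sZero r₁ r₂ ε) m)) -
        qM r₁ r₂ ε (xi r₁ r₁ r₂ ε) m *
          f (-(aEps r₁ r₂ ε * coth (xiM r₁ r₂ ε (xi r₁ r₁ r₂ ε) m))))) -
    Cconst r₁ r₂ ε 2 *
      (∑' m : ℕ, (qM r₁ r₂ ε (xi r₂ r₁ r₂ ε) m *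
          f (aEps r₁ r₂ ε * coth (xiM r₁ r₂ ε (xi r₂ r₁ r₂ ε) m)) -
        qM r₁ r₂ ε (sZero r₁ r₂ ε) m *
          f (-(aEps r₁ r₂ ε * coth (xiM r₁ r₂ ε (sZero r₁ r₂ ε) m)))))) /
    (Cconst r₁ r₂ ε 1 - Cconst r₁ r₂ ε 2)

/-- The limiting concentration factor `C_H`. -/
def CH (f : ℝ → ℝ) (r₁ r₂ : ℝ) : ℝ :=
  4 * Real.pi * muConst r₁ r₂ 1 *
      (∑' m : ℕ, ((rTilde r₁ r₂ / (m + 1)) * f (rTilde r₁ r₂ / (m + 1)) -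
        (rTilde r₁ r₂ / (m + r₂ / (r₁ + r₂))) * f (-(rTilde r₁ r₂ / (m + r₂ / (r₁ + r₂)))))) +
    4 * Real.pi * muConst r₁ r₂ 2 *
      (∑' m : ℕ, ((rTilde r₁ r₂ / (m + r₁ / (r₁ + r₂))) * f (rTilde r₁ r₂ / (m + r₁ / (r₁ + r₂))) -
        (rTilde r₁ r₂ / (m + 1)) * f (-(rTilde r₁ r₂ / (m + 1)))))

/-! ### Elementary hyperbolic inequalities -/

theorem sinh_le_self_mul_cosh {u : ℝ} (hu : 0 ≤ u) : sinh u ≤ u * cosh u := by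
  have hmono : MonotoneOn (fun x : ℝ => x * cosh x - sinh x) (Set.Ici 0) := by
    have hd : ∀ x : ℝ, HasDerivAt (fun x : ℝ => x * cosh x - sinh x) (x * sinh x) x := fun x =>
      (((hasDerivAt_id x).mul (hasDerivAt_cosh x)).sub (hasDerivAt_sinh x)).congr_deriv (by simp)
    refine monotoneOn_of_deriv_nonneg (convex_Ici 0)
      (fun x _ => (hd x).continuousAt.continuousWithinAt)
      (fun x _ => (hd x).differentiableAt.differentiableWithinAt) fun x hx => ?_
    rw [interior_Ici, Set.mem_Ioi] at hx
    rw [(hd x).deriv]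
    exact mul_nonneg hx.le (sinh_nonneg_iff.2 hx.le)
  have h := hmono (Set.mem_Ici.2 le_rfl) (Set.mem_Ici.2 hu) hu
  simp only [cosh_zero, sinh_zero] at h
  linarith

theorem sinh_sub_self_le {u : ℝ} (hu : 0 ≤ u) : sinh u - u ≤ sinh u * (u ^ 2 / 2) := by
  have hs : 0 ≤ sinh u := sinh_nonneg_iff.2 hu
  have h1 : sinh u ≤ u * exp (u ^ 2 / 2) :=
    (sinh_le_self_mul_cosh hu).trans (mul_le_mul_of_nonneg_left (cosh_le_exp_half_sq u) hu)
  have h2 : sinh u * exp (-(u ^ 2 / 2)) ≤ u := by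
    rw [exp_neg, ← div_eq_mul_inv, div_le_iff₀ (exp_pos _)]
    exact h1
  have h3 : 1 - u ^ 2 / 2 ≤ exp (-(u ^ 2 / 2)) := by
    linarith [add_one_le_exp (-(u ^ 2 / 2))]
  nlinarith [mul_le_mul_of_nonneg_left h3 hs]

theorem cosh_sub_one_le_self_mul_sinh {u : ℝ} (hu : 0 ≤ u) : cosh u - 1 ≤ u * sinh u := by
  have h1 := cosh_sq u
  have h2 := sinh_le_self_mul_cosh hu
  have h3 := one_le_cosh u
  have hs : 0 ≤ sinh u := sinh_nonneg_iff.2 hu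
  have h4 : (cosh u - 1) * (cosh u + 1) ≤ (u * sinh u) * (cosh u + 1) := by
    nlinarith [mul_le_mul_of_nonneg_left h2 hs, mul_nonneg hu hs]
  exact le_of_mul_le_mul_right h4 (by linarith)

theorem sq_div_four_le_sinh {u : ℝ} (hu : 0 ≤ u) : u ^ 2 / 4 ≤ sinh u := by
  have h1 := quadratic_le_exp_of_nonneg hu
  have h2 : exp (-u) ≤ 1 := exp_le_one_iff.2 (by linarith)
  rw [sinh_eq]
  linarith

theorem inv_sinh_le {u : ℝ} (hu : 0 < u) : 1 / sinh u ≤ 4 / u ^ 2 := by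
  rw [div_le_div_iff₀ (sinh_pos_iff.2 hu) (by positivity)]
  linarith [sq_div_four_le_sinh hu.le]

theorem inv_le_coth {u : ℝ} (hu : 0 < u) : 1 / u ≤ coth u := by
  rw [coth, div_le_div_iff₀ hu (sinh_pos_iff.2 hu)]
  linarith [sinh_le_self_mul_cosh hu.le]

theorem coth_sub_inv_le {u : ℝ} (hu : 0 < u) : coth u - 1 / u ≤ u := by
  have hs := sinh_pos_iff.2 hu
  have h1 := cosh_sub_one_le_self_mul_sinh hu.le
  have h2 : u ≤ sinh u := self_le_sinh_iff.2 hu.le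
  rw [coth, div_sub_div _ _ hs.ne' hu.ne', div_le_iff₀ (by positivity)]
  nlinarith

theorem coth_le_one_add_inv {u : ℝ} (hu : 0 < u) : coth u ≤ 1 + 1 / u := by
  have hs := sinh_pos_iff.2 hu
  have h2 : u ≤ sinh u := self_le_sinh_iff.2 hu.le
  have h3 : exp (-u) ≤ 1 := exp_le_one_iff.2 (by linarith)
  have h4 : cosh u = sinh u + exp (-u) := by rw [sinh_eq, cosh_eq]; ring
  rw [coth, ← sub_le_iff_le_add, div_sub_div _ _ hs.ne' hu.ne', div_le_iff₀ (by positivity), h4]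
  nlinarith

/-! ### The function `1 / sinh u - 1 / u` and its derivative -/

/-- The difference between the hyperbolic cosecant and its principal part at the origin. -/
def cschReg (u : ℝ) : ℝ := 1 / sinh u - 1 / u

/-- The derivative of `cschReg`. -/
def cschRegDeriv (u : ℝ) : ℝ := 1 / u ^ 2 - cosh u / sinh u ^ 2

theorem hasDerivAt_cschReg {u : ℝ} (hu : 0 < u) : HasDerivAt cschReg (cschRegDeriv u) u := by
  have hs := (sinh_pos_iff.2 hu).ne'
  have e : cschReg = fun v : ℝ => (sinh v)⁻¹ - v⁻¹ := by
    ext v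
    simp [cschReg]
  rw [e]
  refine (((hasDerivAt_sinh u).inv hs).sub (hasDerivAt_inv hu.ne')).congr_deriv ?_
  rw [cschRegDeriv]
  ring

theorem hasDerivAt_cschRegDeriv {u : ℝ} (hu : 0 < u) :
    HasDerivAt cschRegDeriv ((2 + sinh u ^ 2) / sinh u ^ 3 - 2 / u ^ 3) u := by
  have hs := (sinh_pos_iff.2 hu).ne'
  have e : cschRegDeriv = fun v : ℝ => (v ^ 2)⁻¹ - cosh v / sinh v ^ 2 := by
    ext v
    simp [cschRegDeriv]
  rw [e]
  refine (((hasDerivAt_pow 2 u).inv (pow_ne_zero 2 hu.ne')).sub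
    ((hasDerivAt_cosh u).div ((hasDerivAt_sinh u).pow 2) (pow_ne_zero 2 hs))).congr_deriv ?_
  have hu' := hu.ne'
  simp only [Pi.pow_apply]
  field_simp
  rw [cosh_sq u]
  push_cast
  ring

theorem abs_cschReg_le {u : ℝ} (hu : 0 < u) : |cschReg u| ≤ u / 2 := by
  have hs := sinh_pos_iff.2 hu
  have h1 := sinh_sub_self_le hu.le
  have h2 : u ≤ sinh u := self_le_sinh_iff.2 hu.le
  rw [cschReg, div_sub_div _ _ hs.ne' hu.ne', abs_div, abs_of_pos (mul_pos hs hu),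
    div_le_iff₀ (by positivity), abs_le]
  constructor <;> nlinarith

theorem abs_cschReg_le_inv {u : ℝ} (hu : 0 < u) : |cschReg u| ≤ 1 / u := by
  have hs := sinh_pos_iff.2 hu
  have h2 : 1 / sinh u ≤ 1 / u := one_div_le_one_div_of_le hu (self_le_sinh_iff.2 hu.le)
  have h3 : 0 < 1 / sinh u := by positivity
  rw [cschReg, abs_le]
  constructor <;> linarith

theorem tendsto_cschReg_atTop : Filter.Tendsto cschReg Filter.atTop (nhds 0) := by
  have h : Filter.Tendsto (fun u : ℝ => 1 / u) Filter.atTop (nhds 0) := by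
    simpa using tendsto_inv_atTop_zero (𝕜 := ℝ)
  refine squeeze_zero_norm' ?_ h
  filter_upwards [Filter.eventually_gt_atTop 0] with u hu
  exact abs_cschReg_le_inv hu

theorem abs_cschRegDeriv_le {u : ℝ} (hu : 0 < u) : |cschRegDeriv u| ≤ 1 := by
  have hs := sinh_pos_iff.2 hu
  have h1 := sinh_sub_self_le hu.le
  have h2 : u ≤ sinh u := self_le_sinh_iff.2 hu.le
  have h3 := one_le_cosh u
  have h4 := cosh_sq u
  have h5 : 0 < u ^ 2 := by positivity
  rw [cschRegDeriv, div_sub_div _ _ (by positivity) (by positivity), abs_div,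
    abs_of_pos (a := u ^ 2 * sinh u ^ 2) (by positivity), div_le_iff₀ (by positivity), abs_le]
  constructor
  · have : cosh u ≤ 1 + sinh u ^ 2 := by nlinarith
    nlinarith [mul_le_mul_of_nonneg_left this h5.le]
  · have : u ^ 2 ≤ u ^ 2 * cosh u := by nlinarith
    nlinarith [mul_le_mul_of_nonneg_left h1 hs.le]

theorem abs_deriv_cschRegDeriv_le {u : ℝ} (hu : 0 < u) :
    |(2 + sinh u ^ 2) / sinh u ^ 3 - 2 / u ^ 3| ≤ 16 / (u * (1 + u)) := by
  have hs := sinh_pos_iff.2 hu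
  have h1 := sinh_sub_self_le hu.le
  have h2 : u ≤ sinh u := self_le_sinh_iff.2 hu.le
  rcases le_total u 1 with h | h
  · have key : |(2 + sinh u ^ 2) / sinh u ^ 3 - 2 / u ^ 3| ≤ 3 / u := by
      have e : 3 / u = 3 * u ^ 2 * sinh u ^ 3 / (sinh u ^ 3 * u ^ 3) := by
        field_simp
      rw [div_sub_div _ _ (by positivity) (by positivity), abs_div,
        abs_of_pos (a := sinh u ^ 3 * u ^ 3) (by positivity), e]
      gcongr
      have h3 : sinh u ^ 3 - u ^ 3 ≤ 3 * sinh u ^ 2 * (sinh u - u) := by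
        nlinarith [mul_nonneg (sub_nonneg.2 h2) (sub_nonneg.2 h2)]
      have h4 : u ^ 3 ≤ sinh u ^ 3 := by gcongr
      have h5 : 3 * sinh u ^ 2 * (sinh u - u) ≤ 3 * sinh u ^ 2 * (sinh u * (u ^ 2 / 2)) := by
        gcongr
      have h6 : u ^ 3 * sinh u ^ 2 ≤ u ^ 2 * sinh u ^ 3 := by
        have : u ^ 2 * sinh u ^ 2 * u ≤ u ^ 2 * sinh u ^ 2 * sinh u := by gcongr
        nlinarith
      have h7 : 0 ≤ u ^ 3 * sinh u ^ 2 := by positivity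
      have h8 : 0 ≤ u ^ 2 * sinh u ^ 3 := by positivity
      rw [abs_le]
      constructor <;> nlinarith
    refine key.trans ?_
    rw [div_le_div_iff₀ hu (by positivity)]
    nlinarith
  · have h3 := inv_sinh_le hu
    have h4 : 1 / sinh u ^ 3 ≤ 1 / u ^ 3 := by gcongr
    have h5 : 1 / u ^ 3 ≤ 1 / u ^ 2 := by
      gcongr 1 / ?_
      exact pow_le_pow_right₀ h (by norm_num)
    have e1 : (2 + sinh u ^ 2) / sinh u ^ 3 = 2 * (1 / sinh u ^ 3) + 1 / sinh u := by
      field_simp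
    have e2 : 2 / u ^ 3 = 2 * (1 / u ^ 3) := by ring
    have e3 : 4 / u ^ 2 = 4 * (1 / u ^ 2) := by ring
    have p1 : 0 < 1 / sinh u ^ 3 := by positivity
    have p2 : 0 < 1 / sinh u := by positivity
    have p3 : 0 < 1 / u ^ 3 := by positivity
    have key : |(2 + sinh u ^ 2) / sinh u ^ 3 - 2 / u ^ 3| ≤ 8 * (1 / u ^ 2) := by
      rw [e1, e2, abs_le]
      constructor <;> linarith
    refine key.trans ?_
    rw [mul_one_div, div_le_div_iff₀ (by positivity) (by positivity)]
    nlinarith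

theorem abs_cschRegDeriv_sub_le {v s p q : ℝ} (hv : 0 < v) (hp : p ∈ Set.Icc v (v + s))
    (hq : q ∈ Set.Icc v (v + s)) :
    |cschRegDeriv p - cschRegDeriv q| ≤ 16 / (v * (1 + v)) * s := by
  have hle : |p - q| ≤ s := abs_le.2 ⟨by linarith [hp.1, hq.2], by linarith [hp.2, hq.1]⟩
  have h := (convex_Icc v (v + s)).norm_image_sub_le_of_norm_hasDerivWithin_le
    (f := cschRegDeriv) (C := 16 / (v * (1 + v)))
    (fun x hx => (hasDerivAt_cschRegDeriv (hv.trans_le hx.1)).hasDerivWithinAt)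
    (fun x hx => (abs_deriv_cschRegDeriv_le (hv.trans_le hx.1)).trans (by
      have h1 := hx.1
      have h2 := hv.trans_le h1
      gcongr)) hq hp
  refine h.trans ?_
  rw [norm_eq_abs]
  gcongr

theorem exists_cschReg_sub_eq {p q : ℝ} (hp : 0 < p) (hpq : p ≤ q) :
    ∃ c ∈ Set.Icc p q, cschReg q - cschReg p = (q - p) * cschRegDeriv c := by
  rcases hpq.eq_or_lt with rfl | h
  · exact ⟨p, by simp, by simp⟩
  · obtain ⟨c, hc, e⟩ := exists_hasDerivAt_eq_slope cschReg cschRegDeriv h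
      (fun x hx => (hasDerivAt_cschReg (hp.trans_le hx.1)).continuousAt.continuousWithinAt)
      (fun x hx => hasDerivAt_cschReg (hp.trans hx.1))
    refine ⟨c, Set.Ioo_subset_Icc_self hc, ?_⟩
    rw [e, mul_div_cancel₀ _ (sub_pos.2 h).ne']

/-! ### Series estimates -/

/-- The summand of the logarithmically growing series that controls all error terms. -/
def logWeight (s : ℝ) (m : ℕ) : ℝ := 1 / ((m + 1) * (1 + s * (m + 1)))

theorem logWeight_nonneg {s : ℝ} (hs : 0 < s) (m : ℕ) : 0 ≤ logWeight s m := by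
  unfold logWeight
  positivity

theorem sum_range_logWeight_le {s : ℝ} (hs : 0 < s) (n : ℕ) :
    ∑ m ∈ Finset.range (n + 1), logWeight s m ≤
      1 + log ((n + 1) / (1 + s * (n + 1))) + log (1 + s) := by
  induction n with
  | zero =>
    have h1 : (1 : ℝ) / (1 + s) ≤ 1 := by
      rw [div_le_one (by linarith)]
      linarith
    have h2 : log (1 / (1 + s)) = -log (1 + s) := by rw [one_div, log_inv]
    simp only [zero_add, Finset.range_one, Finset.sum_singleton, logWeight, Nat.cast_zero, one_mul,
      mul_one]
    linarith
  | succ n ih =>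
    rw [Finset.sum_range_succ]
    have hn : (0 : ℝ) ≤ n := n.cast_nonneg
    set x : ℝ := ((n : ℝ) + 1) / (1 + s * (n + 1)) with hx
    set y : ℝ := ((n : ℝ) + 1 + 1) / (1 + s * (n + 1 + 1)) with hy
    have hx0 : 0 < x := by positivity
    have hy0 : 0 < y := by positivity
    have h1 : 1 - x / y ≤ log y - log x := by
      have h := one_sub_inv_le_log_of_pos (div_pos hy0 hx0)
      rwa [inv_div, log_div hy0.ne' hx0.ne'] at h
    have h2 : logWeight s (n + 1) ≤ 1 - x / y := by
      have e : 1 - x / y = 1 / (((n : ℝ) + 1 + 1) * (1 + s * (n + 1))) := by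
        rw [hx, hy]
        field_simp
        ring
      rw [e, logWeight]
      push_cast
      gcongr
      linarith
    push_cast
    linarith

theorem sum_range_logWeight_le_sub_log {s : ℝ} (hs : 0 < s) (hs1 : s ≤ 1) (n : ℕ) :
    ∑ m ∈ Finset.range n, logWeight s m ≤ 2 - log s := by
  have h1 : ∑ m ∈ Finset.range n, logWeight s m ≤ ∑ m ∈ Finset.range (n + 1), logWeight s m := by
    rw [Finset.sum_range_succ]
    linarith [logWeight_nonneg hs n]
  have h2 : log (((n : ℝ) + 1) / (1 + s * (n + 1))) ≤ log (1 / s) := by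
    apply log_le_log (by positivity)
    rw [div_le_div_iff₀ (by positivity) hs]
    linarith
  have h3 : log (1 + s) ≤ 1 := by linarith [log_le_sub_one_of_pos (by linarith : 0 < 1 + s)]
  rw [one_div, log_inv] at h2
  linarith [sum_range_logWeight_le hs n]

theorem summable_logWeight {s : ℝ} (hs : 0 < s) (hs1 : s ≤ 1) : Summable (logWeight s) :=
  summable_of_sum_range_le (logWeight_nonneg hs) (sum_range_logWeight_le_sub_log hs hs1)

theorem tsum_logWeight_le {s : ℝ} (hs : 0 < s) (hs1 : s ≤ 1) : ∑' m, logWeight s m ≤ 2 - log s :=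
  Real.tsum_le_of_sum_range_le (logWeight_nonneg hs) (sum_range_logWeight_le_sub_log hs hs1)

theorem abs_tsum_le_of_abs_le {d w : ℕ → ℝ} (hw : Summable w) (h : ∀ m, |d m| ≤ w m) :
    |∑' m, d m| ≤ ∑' m, w m :=
  tsum_of_norm_bounded (f := d) hw.hasSum h

/-- A series whose terms are telescoping differences up to a summable error. -/
theorem abs_tsum_le_of_telescoping {d F w : ℕ → ℝ} {c : ℝ} (hd : Summable d) (hw : Summable w)
    (hF : Filter.Tendsto F Filter.atTop (nhds 0))
    (h : ∀ m, |d (m + 1) - c * (F m - F (m + 1))| ≤ w m) :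
    |∑' m, d m| ≤ |d 0| + |c * F 0| + ∑' m, w m := by
  have hd' : Summable fun m => d (m + 1) := (summable_nat_add_iff 1).2 hd
  have hr : Summable fun m => d (m + 1) - c * (F m - F (m + 1)) := hw.of_norm_bounded h
  have ht : Summable fun m => c * (F m - F (m + 1)) := by
    simpa using hd'.sub hr
  have ht0 : ∑' m, c * (F m - F (m + 1)) = c * F 0 := by
    refine tendsto_nhds_unique ht.hasSum.tendsto_sum_nat ?_
    have e : (fun n => ∑ m ∈ Finset.range n, c * (F m - F (m + 1))) = fun n => c * (F 0 - F n) := by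
      ext n
      rw [← Finset.mul_sum, Finset.sum_range_sub']
    rw [e]
    simpa using (tendsto_const_nhds.sub hF).const_mul c
  have e : ∑' m, d m = d 0 + (c * F 0 + ∑' m, (d (m + 1) - c * (F m - F (m + 1)))) := by
    rw [hd.tsum_eq_zero_add, ← ht0, ← ht.tsum_add hr]
    simp
  have hb := abs_tsum_le_of_abs_le hw h
  rw [e]
  have h1 := abs_add_le (d 0) (c * F 0 + ∑' m, (d (m + 1) - c * (F m - F (m + 1))))
  have h2 := abs_add_le (c * F 0) (∑' m, (d (m + 1) - c * (F m - F (m + 1))))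
  linarith

theorem summable_one_div_add_sq {x : ℝ} (hx : 0 < x) :
    Summable fun m : ℕ => 1 / ((m : ℝ) + x) ^ 2 := by
  have h := (Real.summable_one_div_nat_add_rpow x 2).2 (by norm_num)
  refine h.congr fun m => ?_
  have : 0 < (m : ℝ) + x := by positivity
  rw [abs_of_pos this]
  norm_cast

theorem summable_inv_sinh {s x : ℝ} (hs : 0 < s) (hx : 0 < x) :
    Summable fun m : ℕ => 1 / sinh (s * (m + x)) := by
  refine ((summable_one_div_add_sq hx).mul_left (4 / s ^ 2)).of_norm_bounded fun m => ?_
  have h : 0 < s * (m + x) := by positivity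
  rw [norm_of_nonneg (one_div_nonneg.2 (sinh_nonneg_iff.2 h.le))]
  refine (inv_sinh_le h).trans (le_of_eq ?_)
  rw [mul_pow]
  field_simp

theorem summable_inv_add_sub_inv_add_one {x : ℝ} (hx : 0 < x) :
    Summable fun m : ℕ => 1 / ((m : ℝ) + x) - 1 / (m + 1) := by
  have hx' : 0 < min x 1 := lt_min hx one_pos
  refine ((summable_one_div_add_sq hx').mul_left |1 - x|).of_norm_bounded fun m => ?_
  have hm : (0 : ℝ) ≤ m := m.cast_nonneg
  rw [div_sub_div _ _ (by positivity) (by positivity), norm_eq_abs, abs_div,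
    abs_of_pos (a := ((m : ℝ) + x) * (m + 1)) (by positivity), mul_one_div,
    show 1 * ((m : ℝ) + 1) - (m + x) * 1 = 1 - x by ring]
  gcongr
  rw [sq]
  gcongr
  · exact min_le_left _ _
  · exact min_le_right _ _

theorem tendsto_cschReg_mul_nat {s : ℝ} (hs : 0 < s) :
    Filter.Tendsto (fun m : ℕ => cschReg (s * (m + 1))) Filter.atTop (nhds 0) :=
  tendsto_cschReg_atTop.comp
    ((Filter.tendsto_atTop_add_const_right _ 1 tendsto_natCast_atTop_atTop).const_mul_atTop hs)

theorem abs_tsum_cschRegDeriv_le {s x : ℝ} (hs : 0 < s) (hs1 : s ≤ 1) (hx : 0 < x) (hx1 : x ≤ 1)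
    (hsum : Summable fun m : ℕ => cschRegDeriv (s * (m + x))) :
    |∑' m : ℕ, cschRegDeriv (s * (m + x))| ≤ 34 - 16 * log s := by
  have h := abs_tsum_le_of_telescoping (c := -(1 / s)) hsum
    ((summable_logWeight hs hs1).mul_left 16) (tendsto_cschReg_mul_nat hs) fun m => by
      have hm : (0 : ℝ) ≤ m := m.cast_nonneg
      obtain ⟨q, hq, e⟩ := exists_cschReg_sub_eq (p := s * (m + 1)) (q := s * (m + 1) + s)
        (by positivity) (by linarith)
      have hb := abs_cschRegDeriv_sub_le (s := s) (p := s * (m + 1 + x)) (q := q)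
        (by positivity : 0 < s * ((m : ℝ) + 1)) ⟨by nlinarith, by nlinarith⟩ hq
      have e2 : s * (((m + 1 : ℕ) : ℝ) + 1) = s * (m + 1) + s := by push_cast; ring
      have e3 : -(1 / s) * (cschReg (s * (m + 1)) - cschReg (s * (m + 1) + s)) =
          cschRegDeriv q := by
        rw [← neg_sub, e, neg_mul_neg]
        field_simp
        ring
      have e4 : 16 / (s * ((m : ℝ) + 1) * (1 + s * (m + 1))) * s = 16 * logWeight s m := by
        rw [logWeight]
        field_simp
      rw [e2, e3, ← e4]
      push_cast
      exact hb
  have h0 : |cschRegDeriv (s * ((0 : ℕ) + x))| ≤ 1 := abs_cschRegDeriv_le (by simp; positivity)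
  have h1 : |-(1 / s) * cschReg (s * ((0 : ℕ) + 1))| ≤ 1 := by
    have := abs_cschReg_le hs
    rw [Nat.cast_zero, zero_add, mul_one, abs_mul, abs_neg, abs_of_pos (by positivity),
      one_div_mul_eq_div, div_le_one hs]
    linarith
  refine h.trans ((add_le_add (add_le_add h0 h1) tsum_mul_left.le).trans ?_)
  linarith [tsum_logWeight_le hs hs1]

/-- The series giving, up to a factor, `U` at an interior point minus `U` at zero. -/
def cschDiffSum (s x : ℝ) : ℝ := ∑' m : ℕ, (s / sinh (s * (m + x)) - s / sinh (s * (m + 1)))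

/-- The limit of `cschDiffSum` as `s` tends to zero. -/
def invDiffSum (x : ℝ) : ℝ := ∑' m : ℕ, (1 / ((m : ℝ) + x) - 1 / (m + 1))

theorem summable_cschDiffSum {s x : ℝ} (hs : 0 < s) (hx : 0 < x) :
    Summable fun m : ℕ => s / sinh (s * (m + x)) - s / sinh (s * (m + 1)) := by
  have h := ((summable_inv_sinh hs hx).sub (summable_inv_sinh hs one_pos)).mul_left s
  refine h.congr fun m => ?_
  ring

theorem abs_cschDiffSum_sub_le {s x : ℝ} (hs : 0 < s) (hs1 : s ≤ 1) (hx : 0 < x) (hx1 : x ≤ 1) :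
    |cschDiffSum s x - invDiffSum x| ≤ s ^ 2 * (34 - 16 * log s) := by
  have hA := summable_cschDiffSum hs hx
  have hB := summable_inv_add_sub_inv_add_one hx
  have hterm : ∀ m : ℕ, (s / sinh (s * (m + x)) - s / sinh (s * (m + 1))) -
      (1 / ((m : ℝ) + x) - 1 / (m + 1)) =
      s * (cschReg (s * (m + x)) - cschReg (s * (m + 1))) := fun m => by
    have h1 : sinh (s * (m + x)) ≠ 0 := (sinh_pos_iff.2 (by positivity)).ne'
    have h2 : sinh (s * (m + 1)) ≠ 0 := (sinh_pos_iff.2 (by positivity)).ne'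
    have h3 : (m : ℝ) + x ≠ 0 := by positivity
    rw [cschReg, cschReg]
    field_simp
    ring
  have e : cschDiffSum s x - invDiffSum x =
      ∑' m : ℕ, s * (cschReg (s * (m + x)) - cschReg (s * (m + 1))) := by
    rw [cschDiffSum, invDiffSum, ← hA.tsum_sub hB]
    exact tsum_congr hterm
  have h := abs_tsum_le_of_telescoping (c := s * (1 - x)) ((hA.sub hB).congr hterm)
    ((summable_logWeight hs hs1).mul_left (16 * s ^ 2)) (tendsto_cschReg_mul_nat hs) fun m => by
      have hm : (0 : ℝ) ≤ m := m.cast_nonneg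
      obtain ⟨q, hq, e⟩ := exists_cschReg_sub_eq (p := s * (m + 1)) (q := s * (m + 1) + s)
        (by positivity) (by linarith)
      obtain ⟨p, hp, e'⟩ := exists_cschReg_sub_eq (p := s * (m + 1 + x)) (q := s * (m + 1) + s)
        (by positivity) (by nlinarith)
      have hb := abs_cschRegDeriv_sub_le (s := s) (p := q) (q := p)
        (by positivity : 0 < s * ((m : ℝ) + 1)) hq ⟨le_trans (by nlinarith) hp.1, hp.2⟩
      have e2 : s * (((m + 1 : ℕ) : ℝ) + 1) = s * (m + 1) + s := by push_cast; ring
      have e3 : s * (cschReg (s * (m + 1 + x)) - cschReg (s * (m + 1) + s)) -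
          s * (1 - x) * (cschReg (s * (m + 1)) - cschReg (s * (m + 1) + s)) =
          s ^ 2 * (1 - x) * (cschRegDeriv q - cschRegDeriv p) := by
        linear_combination s * (1 - x) * e - s * e'
      have e4 : 16 / (s * ((m : ℝ) + 1) * (1 + s * (m + 1))) * s = 16 * logWeight s m := by
        rw [logWeight]
        field_simp
      rw [e2]
      push_cast
      rw [e3, abs_mul, abs_of_nonneg (mul_nonneg (sq_nonneg s) (by linarith))]
      rw [e4] at hb
      have h5 : s ^ 2 * (1 - x) ≤ s ^ 2 := by nlinarith [sq_nonneg s]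
      calc _ ≤ s ^ 2 * (16 * logWeight s m) :=
            mul_le_mul h5 hb (abs_nonneg _) (sq_nonneg s)
        _ = _ := by ring
  have h0 : |s * (cschReg (s * ((0 : ℕ) + x)) - cschReg (s * ((0 : ℕ) + 1)))| ≤ s ^ 2 := by
    have h1 := abs_cschReg_le hs
    have h2 := abs_cschReg_le (mul_pos hs hx)
    have h3 := abs_sub (cschReg (s * x)) (cschReg s)
    have h4 : s * x ≤ s := by nlinarith
    simp only [Nat.cast_zero, zero_add, mul_one]
    rw [abs_mul, abs_of_pos hs, sq]
    exact mul_le_mul_of_nonneg_left (by linarith) hs.le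
  have h1 : |s * (1 - x) * cschReg (s * ((0 : ℕ) + 1))| ≤ s ^ 2 := by
    have h1 := abs_cschReg_le hs
    simp only [Nat.cast_zero, zero_add, mul_one]
    rw [abs_mul, abs_mul, abs_of_pos hs, abs_of_nonneg (by linarith : 0 ≤ 1 - x), mul_assoc, sq]
    refine mul_le_mul_of_nonneg_left ?_ hs.le
    nlinarith [abs_nonneg (cschReg s)]
  have h2 := mul_le_mul_of_nonneg_left (tsum_logWeight_le hs hs1) (sq_nonneg s)
  rw [e]
  refine h.trans ((add_le_add (add_le_add h0 h1) tsum_mul_left.le).trans ?_)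
  linarith

theorem abs_invDiffSum_sub_le {x₀ x y : ℝ} (hx₀ : 0 < x₀) (hx : x₀ ≤ x) (hy : x₀ ≤ y) :
    |invDiffSum x - invDiffSum y| ≤ |x - y| * ∑' m : ℕ, 1 / ((m : ℝ) + x₀) ^ 2 := by
  have hA := summable_inv_add_sub_inv_add_one (hx₀.trans_le hx)
  have hB := summable_inv_add_sub_inv_add_one (hx₀.trans_le hy)
  rw [invDiffSum, invDiffSum, ← hA.tsum_sub hB, ← tsum_mul_left]
  refine abs_tsum_le_of_abs_le ((summable_one_div_add_sq hx₀).mul_left _) fun m => ?_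
  have h1 : 0 < (m : ℝ) + x := by have := hx₀.trans_le hx; positivity
  have h2 : 0 < (m : ℝ) + y := by have := hx₀.trans_le hy; positivity
  have e : (1 / ((m : ℝ) + x) - 1 / (m + 1)) - (1 / ((m : ℝ) + y) - 1 / (m + 1)) =
      (y - x) / ((m + x) * (m + y)) := by
    field_simp
    ring
  rw [e, abs_div, abs_of_pos (mul_pos h1 h2), abs_sub_comm, mul_one_div, sq]
  gcongr

theorem invDiffSum_pos {x : ℝ} (hx : 0 < x) (hx1 : x < 1) : 0 < invDiffSum x := by
  have h : ∀ m : ℕ, 0 < 1 / ((m : ℝ) + x) - 1 / (m + 1) := fun m => by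
    rw [sub_pos]
    gcongr
  exact (summable_inv_add_sub_inv_add_one hx).tsum_pos (fun m => (h m).le) 0 (h 0)

theorem cschDiffSum_pos {s x : ℝ} (hs : 0 < s) (hx : 0 < x) (hx1 : x < 1) :
    0 < cschDiffSum s x := by
  have h : ∀ m : ℕ, 0 < s / sinh (s * (m + x)) - s / sinh (s * (m + 1)) := fun m => by
    have h1 : 0 < sinh (s * (m + x)) := sinh_pos_iff.2 (by positivity)
    have h2 : sinh (s * (m + x)) < sinh (s * (m + 1)) := sinh_lt_sinh.2 (by gcongr)
    rw [sub_pos]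
    gcongr
  exact (summable_cschDiffSum hs hx).tsum_pos (fun m => (h m).le) 0 (h 0)

/-! ### Functions with a quadratic remainder at the origin -/

/-- `f` vanishes at the origin and `f t - β t` has a locally quadratic modulus of continuity. -/
def HasQuadraticRemainder (f : ℝ → ℝ) (β : ℝ) : Prop :=
  f 0 = 0 ∧ ∀ R : ℝ, ∃ M ≥ 0, ∀ t t' : ℝ, |t'| ≤ |t| → |t| ≤ R →
    |(f t - β * t) - (f t' - β * t')| ≤ M * |t| * |t - t'|

theorem hasQuadraticRemainder_id : HasQuadraticRemainder (fun t => t) 1 :=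
  ⟨rfl, fun _ => ⟨0, le_rfl, by simp⟩⟩

theorem HasQuadraticRemainder.comp_neg {f : ℝ → ℝ} {β : ℝ} (hf : HasQuadraticRemainder f β) :
    HasQuadraticRemainder (fun t => f (-t)) (-β) := by
  refine ⟨by simpa using hf.1, fun R => ?_⟩
  obtain ⟨M, hM, h⟩ := hf.2 R
  refine ⟨M, hM, fun t t' h1 h2 => ?_⟩
  have h3 := h (-t) (-t') (by simpa using h1) (by simpa using h2)
  rw [abs_neg, show -t - -t' = -(t - t') by ring, abs_neg] at h3
  simpa using h3

theorem HasQuadraticRemainder.exists_lipschitz {f : ℝ → ℝ} {β : ℝ}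
    (hf : HasQuadraticRemainder f β) (R : ℝ) :
    ∃ L ≥ 0, ∀ t t' : ℝ, |t| ≤ R → |t'| ≤ R → |f t - f t'| ≤ L * |t - t'| := by
  obtain ⟨M, hM, h⟩ := hf.2 R
  have key : ∀ t t' : ℝ, |t'| ≤ |t| → |t| ≤ R → |f t - f t'| ≤ (|β| + M * |R|) * |t - t'| := by
    intro t t' h1 h2
    have h3 := h t t' h1 h2
    have h4 : M * |t| * |t - t'| ≤ M * |R| * |t - t'| := by
      have := h2.trans (le_abs_self R)
      gcongr
    have h5 := abs_add_le ((f t - β * t) - (f t' - β * t')) (β * (t - t'))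
    rw [abs_mul, show (f t - β * t) - (f t' - β * t') + β * (t - t') = f t - f t' by ring] at h5
    linarith
  refine ⟨|β| + M * |R|, by positivity, fun t t' h1 h2 => ?_⟩
  rcases le_total |t'| |t| with h3 | h3
  · exact key t t' h3 h1
  · rw [abs_sub_comm, abs_sub_comm t]
    exact key t' t h3 h2

theorem hasQuadraticRemainder_of_powerSeries {f : ℝ → ℝ} {b : ℕ → ℝ} (hb0 : b 0 = 0)
    (hbsum : ∀ R > 0, Summable fun k : ℕ => |b k| * R ^ k)
    (hf : ∀ t : ℝ, f t = ∑' k : ℕ, b k * t ^ k) : HasQuadraticRemainder f (b 1) := by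
  have hs : ∀ t : ℝ, Summable fun k : ℕ => b k * t ^ k := fun t => by
    refine (hbsum (|t| + 1) (by positivity)).of_norm_bounded fun k => ?_
    rw [norm_eq_abs, abs_mul, abs_pow]
    gcongr
    linarith
  have hs2 : ∀ t : ℝ, Summable fun k : ℕ => b (k + 2) * t ^ (k + 2) := fun t =>
    (summable_nat_add_iff 2).2 (hs t)
  have hrem : ∀ t : ℝ, f t - b 1 * t = ∑' k : ℕ, b (k + 2) * t ^ (k + 2) := fun t => by
    have h := (hs t).sum_add_tsum_nat_add 2
    rw [← hf, Finset.sum_range_succ, Finset.sum_range_one, hb0] at h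
    linear_combination -h
  refine ⟨by rw [hf]; exact (tsum_congr fun k => by cases k <;> simp [hb0]).trans tsum_zero,
    fun R => ?_⟩
  have hR : 1 ≤ |R| + 1 := by linarith [abs_nonneg R]
  have hw := (summable_nat_add_iff 2).2 (hbsum (2 * (|R| + 1)) (by positivity))
  refine ⟨∑' k : ℕ, |b (k + 2)| * (2 * (|R| + 1)) ^ (k + 2), tsum_nonneg fun k => by positivity,
    fun t t' h1 h2 => ?_⟩
  rw [hrem, hrem, ← (hs2 t).tsum_sub (hs2 t'), mul_assoc, ← tsum_mul_right]
  refine abs_tsum_le_of_abs_le (hw.mul_right _) fun k => ?_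
  have h3 : |t ^ (k + 2) - t' ^ (k + 2)| ≤ |t - t'| * (k + 2 : ℕ) * |t| ^ (k + 1) := by
    have h := abs_pow_sub_pow_le t t' (k + 2)
    rwa [max_eq_left h1] at h
  have h4 : ((k + 2 : ℕ) : ℝ) ≤ 2 ^ (k + 2) := by exact_mod_cast Nat.lt_two_pow_self.le
  have h5 : |t| ^ k ≤ (|R| + 1) ^ (k + 2) :=
    (pow_le_pow_left₀ (abs_nonneg t) (by linarith [le_abs_self R]) k).trans
      (pow_le_pow_right₀ hR (by omega))
  rw [← mul_sub, abs_mul, mul_assoc, mul_pow]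
  refine mul_le_mul_of_nonneg_left ?_ (abs_nonneg _)
  calc _ ≤ |t - t'| * (k + 2 : ℕ) * |t| ^ (k + 1) := h3
    _ = ((k + 2 : ℕ) * |t| ^ k) * (|t| * |t - t'|) := by ring
    _ ≤ _ := by gcongr

/-! ### The concentration series and their limits -/

/-- The summand of the series over image charges at a positive distance. -/
def cothTerm (f : ℝ → ℝ) (ρ s x : ℝ) (m : ℕ) : ℝ :=
  ρ * s / sinh (s * (m + x)) * f (ρ * s * coth (s * (m + x)))

/-- The limit of `cothTerm` as `s` tends to zero. -/
def limTerm (f : ℝ → ℝ) (ρ x : ℝ) (m : ℕ) : ℝ := ρ / (m + x) * f (ρ / (m + x))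

theorem div_add_le {ρ R₀ x x₀ : ℝ} (hx₀ : 0 < x₀) (hx : x₀ ≤ x) (hρ : 0 < ρ) (hρR : ρ ≤ R₀)
    (m : ℕ) : ρ / (m + x) ≤ R₀ / x₀ := by
  have hm : (0 : ℝ) ≤ m := m.cast_nonneg
  have := hρ.trans_le hρR
  gcongr
  linarith

theorem mul_coth_le {ρ s x : ℝ} (hs : 0 < s) (hx : 0 < x) (hρ : 0 < ρ) (m : ℕ) :
    ρ * s * coth (s * (m + x)) ≤ ρ * s + ρ / (m + x) := by
  have hu : 0 < s * (m + x) := by positivity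
  refine (mul_le_mul_of_nonneg_left (coth_le_one_add_inv hu) (by positivity)).trans (le_of_eq ?_)
  field_simp

theorem coth_pos {u : ℝ} (hu : 0 < u) : 0 < coth u :=
  (one_div_pos.2 hu).trans_le (inv_le_coth hu)

theorem summable_cothTerm {f : ℝ → ℝ} {β ρ s x : ℝ} (hf : HasQuadraticRemainder f β) (hs : 0 < s)
    (hx : 0 < x) (hρ : 0 < ρ) : Summable (cothTerm f ρ s x) := by
  obtain ⟨L, hL, h⟩ := hf.exists_lipschitz (ρ * s + ρ / x)
  refine ((summable_inv_sinh hs hx).mul_left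
    (ρ * s * (L * (ρ * s + ρ / x)))).of_norm_bounded fun m => ?_
  have hu : 0 < s * (m + x) := by positivity
  have h1 : 0 < ρ * s * coth (s * (m + x)) := mul_pos (by positivity) (coth_pos hu)
  have h2 : ρ * s * coth (s * (m + x)) ≤ ρ * s + ρ / x :=
    (mul_coth_le hs hx hρ m).trans (by linarith [div_add_le hx le_rfl hρ le_rfl m])
  have h3 := h (ρ * s * coth (s * (m + x))) 0 (by rwa [abs_of_pos h1]) (by simp; positivity)
  rw [hf.1, sub_zero, sub_zero, abs_of_pos h1] at h3
  have h4 := sinh_pos_iff.2 hu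
  rw [cothTerm, norm_eq_abs, abs_mul, abs_of_pos (by positivity)]
  calc _ ≤ ρ * s / sinh (s * (m + x)) * (L * (ρ * s + ρ / x)) := by
        refine mul_le_mul_of_nonneg_left (h3.trans ?_) (by positivity)
        gcongr
    _ = _ := by ring

theorem abs_limTerm_le {f : ℝ → ℝ} {R₀ x₀ L : ℝ} (hf0 : f 0 = 0) (hL : 0 ≤ L)
    (h : ∀ t t' : ℝ, |t| ≤ R₀ / x₀ → |t'| ≤ R₀ / x₀ → |f t - f t'| ≤ L * |t - t'|)
    {ρ x : ℝ} (hx₀ : 0 < x₀) (hx : x₀ ≤ x) (hρ : 0 < ρ) (hρR : ρ ≤ R₀) (m : ℕ) :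
    |limTerm f ρ x m| ≤ L * R₀ ^ 2 * (1 / ((m : ℝ) + x₀) ^ 2) := by
  have hR := hρ.trans_le hρR
  have hx' := hx₀.trans_le hx
  have h1 : 0 < ρ / ((m : ℝ) + x) := by positivity
  have h3 := h (ρ / (m + x)) 0 (by rw [abs_of_pos h1]; exact div_add_le hx₀ hx hρ hρR m)
    (by simp; positivity)
  rw [hf0, sub_zero, sub_zero, abs_of_pos h1] at h3
  have h4 : ρ / ((m : ℝ) + x) ≤ R₀ / (m + x₀) := by gcongr
  rw [limTerm, abs_mul, abs_of_pos h1]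
  calc _ ≤ R₀ / ((m : ℝ) + x₀) * (L * (R₀ / (m + x₀))) := by
        refine mul_le_mul h4 (h3.trans ?_) (abs_nonneg _) (by positivity)
        gcongr
    _ = _ := by
      field_simp

theorem summable_limTerm {f : ℝ → ℝ} {β ρ x : ℝ} (hf : HasQuadraticRemainder f β)
    (hx : 0 < x) (hρ : 0 < ρ) : Summable (limTerm f ρ x) := by
  obtain ⟨L, hL, h⟩ := hf.exists_lipschitz (ρ / x)
  exact ((summable_one_div_add_sq hx).mul_left _).of_norm_bounded
    (abs_limTerm_le hf.1 hL h hx le_rfl hρ le_rfl)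

theorem exists_abs_tsum_limTerm_sub_le {f : ℝ → ℝ} {β x₀ R₀ : ℝ} (hf : HasQuadraticRemainder f β)
    (hx₀ : 0 < x₀) (hR₀ : 0 < R₀) :
    ∃ C ≥ 0, ∀ x y ρ σ : ℝ, x₀ ≤ x → x₀ ≤ y → 0 < ρ → ρ ≤ R₀ → 0 < σ → σ ≤ R₀ →
      |∑' m, limTerm f ρ x m - ∑' m, limTerm f σ y m| ≤ C * (|ρ - σ| + |x - y|) := by
  obtain ⟨L, hL, h⟩ := hf.exists_lipschitz (R₀ / x₀)
  refine ⟨2 * L * R₀ * (1 + R₀ / x₀) * ∑' m : ℕ, 1 / ((m : ℝ) + x₀) ^ 2, ?_, ?_⟩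
  · have : 0 ≤ ∑' m : ℕ, 1 / ((m : ℝ) + x₀) ^ 2 := tsum_nonneg fun m => by positivity
    positivity
  intro x y ρ σ hx hy hρ hρR hσ hσR
  have hx' := hx₀.trans_le hx
  have hy' := hx₀.trans_le hy
  rw [← (summable_limTerm hf hx' hρ).tsum_sub (summable_limTerm hf hy' hσ), mul_right_comm,
    ← tsum_mul_left]
  refine abs_tsum_le_of_abs_le ((summable_one_div_add_sq hx₀).mul_left _) fun m => ?_
  have hm : (0 : ℝ) ≤ m := m.cast_nonneg
  set q : ℝ := 1 / ((m : ℝ) + x₀) with hq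
  have hq0 : 0 < q := by positivity
  have hqx : q ≤ 1 / x₀ := by
    rw [hq]
    gcongr
    linarith
  have hi : 1 / ((m : ℝ) + x) ≤ q := by rw [hq]; gcongr
  have hj : 1 / ((m : ℝ) + y) ≤ q := by rw [hq]; gcongr
  have hi0 : 0 < 1 / ((m : ℝ) + x) := by positivity
  have hj0 : 0 < 1 / ((m : ℝ) + y) := by positivity
  set t : ℝ := ρ / (m + x) with ht
  set t' : ℝ := σ / (m + y) with ht'
  have ht0 : 0 < t := by positivity
  have ht0' : 0 < t' := by positivity
  have htR : t ≤ R₀ / x₀ := div_add_le hx₀ hx hρ hρR m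
  have htR' : t' ≤ R₀ / x₀ := div_add_le hx₀ hy hσ hσR m
  have htq : t ≤ R₀ * q := by
    rw [ht, div_eq_mul_one_div]
    gcongr
  have htq' : t' ≤ R₀ * q := by
    rw [ht', div_eq_mul_one_div]
    gcongr
  have hdiff : |t - t'| ≤ (1 + R₀ / x₀) * (|ρ - σ| + |x - y|) * q := by
    have e : t - t' = (ρ - σ) * (1 / (m + x)) + σ * (1 / (m + x)) * (1 / (m + y)) * (y - x) := by
      rw [ht, ht']
      field_simp
      ring
    have h1 : |(ρ - σ) * (1 / (m + x))| ≤ |ρ - σ| * q := by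
      rw [abs_mul, abs_of_pos hi0]
      gcongr
    have h2 : |σ * (1 / (m + x)) * (1 / (m + y)) * (y - x)| ≤ R₀ * (1 / x₀) * q * |x - y| := by
      rw [abs_mul, abs_of_pos (by positivity), abs_sub_comm]
      have := hi.trans hqx
      gcongr
    rw [e]
    refine (abs_add_le _ _).trans ((add_le_add h1 h2).trans ?_)
    have h3 : 0 ≤ R₀ / x₀ * q * |ρ - σ| := by positivity
    have h4 : 0 ≤ q * |x - y| := by positivity
    have e2 : R₀ * (1 / x₀) = R₀ / x₀ := by ring
    rw [e2]
    linarith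
  have h1 := h t 0 (by rwa [abs_of_pos ht0]) (by simp; positivity)
  rw [hf.1, sub_zero, sub_zero, abs_of_pos ht0] at h1
  have h2 := h t t' (by rwa [abs_of_pos ht0]) (by rwa [abs_of_pos ht0'])
  have e : limTerm f ρ x m - limTerm f σ y m = (t - t') * f t + t' * (f t - f t') := by
    rw [limTerm, limTerm]
    ring
  rw [e]
  calc |(t - t') * f t + t' * (f t - f t')| ≤ |t - t'| * |f t| + t' * |f t - f t'| := by
        refine (abs_add_le _ _).trans (le_of_eq ?_)
        rw [abs_mul, abs_mul, abs_of_pos ht0']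
    _ ≤ |t - t'| * (L * (R₀ * q)) + R₀ * q * (L * |t - t'|) := by
        have h3 : |f t| ≤ L * (R₀ * q) := h1.trans (by gcongr)
        gcongr
    _ = 2 * L * R₀ * q * |t - t'| := by ring
    _ ≤ 2 * L * R₀ * q * ((1 + R₀ / x₀) * (|ρ - σ| + |x - y|) * q) := by gcongr
    _ = _ := by
        rw [hq]
        field_simp

theorem abs_remainder_sub_le {g : ℝ → ℝ} {a u M R : ℝ} (ha : 0 < a) (hu : 0 < u) (hM : 0 ≤ M)
    (hg0 : g 0 = 0) (haR : a * (1 + 1 / u) ≤ R)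
    (h : ∀ t t' : ℝ, |t'| ≤ |t| → |t| ≤ R → |g t - g t'| ≤ M * |t| * |t - t'|) :
    |a / sinh u * g (a * coth u) - a / u * g (a / u)| ≤ M * a ^ 3 * (34 / (u * (1 + u))) := by
  have hc := coth_pos hu
  have hic := inv_le_coth hu
  have hc1 := coth_le_one_add_inv hu
  have hci := coth_sub_inv_le hu
  have hi : 0 < 1 / u := by positivity
  have hs := sinh_pos_iff.2 hu
  have hk : 0 < 1 / sinh u := by positivity
  have hkr : a / sinh u = a * (1 / sinh u) := by ring
  have hir : a / u = a * (1 / u) := by ring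
  have hkreg : |1 / sinh u - 1 / u| ≤ u / 2 := abs_cschReg_le hu
  have hk4 := inv_sinh_le hu
  have hiu : 1 / u * u = 1 := by field_simp
  rw [hkr, hir]
  set c := coth u
  set k := 1 / sinh u
  set i := 1 / u with hidef
  have h1 : a * c ≤ R := (mul_le_mul_of_nonneg_left hc1 ha.le).trans haR
  have h2 : a * i ≤ a * c := by gcongr
  have hac : 0 < a * c := by positivity
  have hai : 0 < a * i := by positivity
  have hgc : |g (a * c)| ≤ M * a ^ 2 * c ^ 2 := by
    have := h (a * c) 0 (by rw [abs_zero]; exact abs_nonneg _) (by rwa [abs_of_pos hac])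
    rw [hg0, sub_zero, sub_zero, abs_of_pos hac] at this
    exact this.trans (le_of_eq (by ring))
  have hgi : |g (a * i)| ≤ M * a ^ 2 * i ^ 2 := by
    have := h (a * i) 0 (by rw [abs_zero]; exact abs_nonneg _) (by rw [abs_of_pos hai]; linarith)
    rw [hg0, sub_zero, sub_zero, abs_of_pos hai] at this
    exact this.trans (le_of_eq (by ring))
  rcases le_total u 1 with hu1 | hu1
  · have hi1 : 1 ≤ i := by
      rw [hidef, le_div_iff₀ hu]
      linarith
    have hc2 : c ≤ 2 * i := by linarith
    have hd : |g (a * c) - g (a * i)| ≤ M * a ^ 2 * c * u := by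
      have := h (a * c) (a * i) (by rwa [abs_of_pos hac, abs_of_pos hai])
        (by rwa [abs_of_pos hac])
      rw [abs_of_pos hac, ← mul_sub,
        abs_of_nonneg (a := a * (c - i)) (mul_nonneg ha.le (sub_nonneg.2 hic))] at this
      refine this.trans ?_
      have e : M * (a * c) * (a * (c - i)) = M * a ^ 2 * c * (c - i) := by ring
      rw [e]
      gcongr
    calc |a * k * g (a * c) - a * i * g (a * i)|
        = |a * (k - i) * g (a * c) + a * i * (g (a * c) - g (a * i))| := by congr 1; ring
      _ ≤ a * |k - i| * |g (a * c)| + a * i * |g (a * c) - g (a * i)| := by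
          refine (abs_add_le _ _).trans (le_of_eq ?_)
          rw [abs_mul, abs_mul, abs_mul (a * i), abs_of_pos ha, abs_of_pos hai]
      _ ≤ a * (u / 2) * (M * a ^ 2 * (2 * i) ^ 2) + a * i * (M * a ^ 2 * (2 * i) * u) := by
          have h3 : |g (a * c)| ≤ M * a ^ 2 * (2 * i) ^ 2 := hgc.trans (by gcongr)
          have h4 : |g (a * c) - g (a * i)| ≤ M * a ^ 2 * (2 * i) * u := hd.trans (by gcongr)
          gcongr
      _ = M * a ^ 3 * (4 * i) := by
          linear_combination (4 * M * a ^ 3 * i) * hiu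
      _ ≤ M * a ^ 3 * (34 / (u * (1 + u))) := by
          gcongr
          rw [hidef, mul_one_div, div_le_div_iff₀ hu (by positivity)]
          nlinarith
  · have hi1 : i ≤ 1 := by
      rw [hidef, div_le_one hu]
      exact hu1
    have hk' : k ≤ 4 * i ^ 2 := hk4.trans (le_of_eq (by rw [hidef]; ring))
    calc |a * k * g (a * c) - a * i * g (a * i)|
        ≤ a * k * |g (a * c)| + a * i * |g (a * i)| := by
          refine (abs_sub _ _).trans (le_of_eq ?_)
          rw [abs_mul, abs_mul (a * i), abs_of_pos (mul_pos ha hk), abs_of_pos hai]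
      _ ≤ a * (4 * i ^ 2) * (M * a ^ 2 * 2 ^ 2) + a * 1 * (M * a ^ 2 * i ^ 2) := by
          have h3 : |g (a * c)| ≤ M * a ^ 2 * 2 ^ 2 := by
            refine hgc.trans ?_
            have : c ≤ 2 := by linarith
            gcongr
          gcongr
      _ = M * a ^ 3 * (17 * i ^ 2) := by ring
      _ ≤ M * a ^ 3 * (34 / (u * (1 + u))) := by
          gcongr
          rw [hidef, div_pow, one_pow, mul_one_div, div_le_div_iff₀ (by positivity) (by positivity)]
          nlinarith

theorem cothTerm_sub_limTerm {f : ℝ → ℝ} {β ρ s x : ℝ} (hs : 0 < s) (hx : 0 < x) (m : ℕ) :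
    cothTerm f ρ s x m - limTerm f ρ x m =
      -(β * (ρ * s) ^ 2) * cschRegDeriv (s * (m + x)) +
      (ρ * s / sinh (s * (m + x)) * (f (ρ * s * coth (s * (m + x))) -
          β * (ρ * s * coth (s * (m + x)))) -
        ρ * s / (s * (m + x)) * (f (ρ * s / (s * (m + x))) - β * (ρ * s / (s * (m + x))))) := by
  have h1 : sinh (s * (m + x)) ≠ 0 := (sinh_pos_iff.2 (by positivity)).ne'
  have h2 : ρ * s / (s * (m + x)) = ρ / (m + x) := by
    field_simp
  rw [cothTerm, limTerm, h2, cschRegDeriv, coth]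
  field_simp
  ring

theorem summable_cschRegDeriv {s x : ℝ} (hs : 0 < s) (hx : 0 < x) :
    Summable fun m : ℕ => cschRegDeriv (s * (m + x)) := by
  have h := ((summable_cothTerm hasQuadraticRemainder_id hs hx one_pos).sub
    (summable_limTerm hasQuadraticRemainder_id hx one_pos)).mul_left (-(1 / s ^ 2))
  refine h.congr fun m => ?_
  rw [cothTerm_sub_limTerm (β := 1) hs hx]
  field_simp
  ring

theorem exists_abs_tsum_cothTerm_sub_le {f : ℝ → ℝ} {β x₀ R₀ : ℝ} (hf : HasQuadraticRemainder f β)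
    (hx₀ : 0 < x₀) (hR₀ : 0 < R₀) :
    ∃ C ≥ 0, ∀ s x ρ : ℝ, 0 < s → s ≤ 1 → x₀ ≤ x → x ≤ 1 → 0 < ρ → ρ ≤ R₀ →
      |∑' m, cothTerm f ρ s x m - ∑' m, limTerm f ρ x m| ≤ C * (s ^ 2 * (1 - log s)) := by
  obtain ⟨M, hM, h⟩ := hf.2 (R₀ + R₀ / x₀)
  refine ⟨34 * |β| * R₀ ^ 2 + 34 * M * R₀ ^ 3 * (1 / x₀ + 2), by positivity, ?_⟩
  intro s x ρ hs hs1 hx hx1 hρ hρR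
  have hx' := hx₀.trans_le hx
  have hlog : log s ≤ 0 := log_nonpos hs.le hs1
  have hderiv := summable_cschRegDeriv hs hx'
  have hsum := (summable_cothTerm hf hs hx' hρ).sub (summable_limTerm hf hx' hρ)
  set rem : ℕ → ℝ := fun m => ρ * s / sinh (s * (m + x)) * (f (ρ * s * coth (s * (m + x))) -
          β * (ρ * s * coth (s * (m + x)))) -
        ρ * s / (s * (m + x)) * (f (ρ * s / (s * (m + x))) - β * (ρ * s / (s * (m + x)))) with hrem
  have hsplit : ∀ m, cothTerm f ρ s x m - limTerm f ρ x m =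
      -(β * (ρ * s) ^ 2) * cschRegDeriv (s * (m + x)) + rem m :=
    cothTerm_sub_limTerm hs hx'
  have hremsum : Summable rem := by
    refine (hsum.sub (hderiv.mul_left (-(β * (ρ * s) ^ 2)))).congr fun m => ?_
    rw [hsplit]
    ring
  have hremle : ∀ m : ℕ, |rem m| ≤
      34 * M * R₀ ^ 3 * s ^ 2 * (1 / ((m + x) * (1 + s * (m + x)))) := fun m => by
    have hm : (0 : ℝ) ≤ m := m.cast_nonneg
    refine (abs_remainder_sub_le (g := fun t => f t - β * t) (a := ρ * s) (u := s * (m + x))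
      (by positivity) (by positivity) hM (by simp [hf.1]) ?_ h).trans ?_
    · have h1 := div_add_le hx₀ hx hρ hρR m
      have h2 : ρ * s ≤ R₀ := by nlinarith
      have e : ρ * s * (1 + 1 / (s * (m + x))) = ρ * s + ρ / (m + x) := by
        field_simp
      linarith
    · have e : M * (ρ * s) ^ 3 * (34 / (s * (m + x) * (1 + s * (m + x)))) =
          34 * M * ρ ^ 3 * s ^ 2 * (1 / ((m + x) * (1 + s * (m + x)))) := by
        field_simp
      rw [e]
      gcongr
  have hremtsum := abs_tsum_le_of_telescoping (c := 0) (F := fun _ => 0) hremsum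
    ((summable_logWeight hs hs1).mul_left (34 * M * R₀ ^ 3 * s ^ 2)) tendsto_const_nhds fun m => by
      have hm : (0 : ℝ) ≤ m := m.cast_nonneg
      rw [zero_mul, sub_zero]
      refine (hremle (m + 1)).trans ?_
      rw [logWeight]
      push_cast
      have h1 : s * ((m : ℝ) + 1) ≤ s * (m + 1 + x) := by nlinarith
      exact mul_le_mul_of_nonneg_left (one_div_le_one_div_of_le (by positivity)
        (mul_le_mul (by linarith) (by linarith) (by positivity) (by positivity))) (by positivity)
  have hrem0 : |rem 0| ≤ 34 * M * R₀ ^ 3 * s ^ 2 * (1 / x₀) := by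
    refine (hremle 0).trans ?_
    simp only [Nat.cast_zero, zero_add]
    gcongr
    nlinarith [mul_pos hs hx', mul_pos (mul_pos hs hx') hx']
  rw [tsum_mul_left, mul_zero, abs_zero, add_zero] at hremtsum
  have hw := tsum_logWeight_le hs hs1
  have hrem' : |∑' m, rem m| ≤ 34 * M * R₀ ^ 3 * s ^ 2 * (1 / x₀ + (2 - log s)) := by
    have := mul_le_mul_of_nonneg_left hw (by positivity : 0 ≤ 34 * M * R₀ ^ 3 * s ^ 2)
    linarith
  have hlin : |-(β * (ρ * s) ^ 2) * ∑' m : ℕ, cschRegDeriv (s * (m + x))| ≤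
      |β| * (R₀ ^ 2 * s ^ 2) * (34 - 16 * log s) := by
    rw [abs_mul, abs_neg, abs_mul, abs_of_nonneg (sq_nonneg (ρ * s)), mul_pow]
    have h1 := abs_tsum_cschRegDeriv_le hs hs1 hx' hx1 hderiv
    gcongr
  rw [← (summable_cothTerm hf hs hx' hρ).tsum_sub (summable_limTerm hf hx' hρ), tsum_congr hsplit,
    (hderiv.mul_left _).tsum_add hremsum, tsum_mul_left]
  refine (abs_add_le _ _).trans ((add_le_add hlin hrem').trans ?_)
  have h1 : |β| * (R₀ ^ 2 * s ^ 2) * (34 - 16 * log s) ≤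
      |β| * (R₀ ^ 2 * s ^ 2) * (34 * (1 - log s)) := by
    gcongr
    linarith
  have h2 : 34 * M * R₀ ^ 3 * s ^ 2 * (1 / x₀ + (2 - log s)) ≤
      34 * M * R₀ ^ 3 * s ^ 2 * ((1 / x₀ + 2) * (1 - log s)) := by
    have : 0 < 1 / x₀ := by positivity
    gcongr
    nlinarith
  linarith

theorem one_le_one_sub_log {s : ℝ} (hs : 0 < s) (hs1 : s ≤ 1) : 1 ≤ 1 - log s := by
  linarith [log_nonpos hs.le hs1]

theorem exists_abs_tsum_cothTerm_sub_limTerm_le {f : ℝ → ℝ} {β x₀ R K : ℝ}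
    (hf : HasQuadraticRemainder f β) (hx₀ : 0 < x₀) (hR : 0 < R) :
    ∃ C ≥ 0, ∀ s x ρ : ℝ, 0 < s → s ≤ 1 → x₀ / 2 ≤ x → x ≤ 1 → 0 < ρ → ρ ≤ 2 * R →
      |ρ - R| ≤ K * s ^ 2 → |x - x₀| ≤ K * s ^ 2 →
      |∑' m, cothTerm f ρ s x m - ∑' m, limTerm f R x₀ m| ≤ C * (s ^ 2 * (1 - log s)) := by
  obtain ⟨C, hC, h⟩ := exists_abs_tsum_cothTerm_sub_le (x₀ := x₀ / 2) (R₀ := 2 * R) hf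
    (by linarith) (by linarith)
  obtain ⟨D, hD, h'⟩ := exists_abs_tsum_limTerm_sub_le (x₀ := x₀ / 2) (R₀ := 2 * R) hf
    (by linarith) (by linarith)
  refine ⟨C + D * (2 * |K|), by positivity, fun s x ρ hs hs1 hx hx1 hρ hρR hK hK' => ?_⟩
  have h1 := h s x ρ hs hs1 hx hx1 hρ hρR
  have h2 := h' x x₀ ρ R hx (by linarith) hρ hρR hR (by linarith)
  have h3 := one_le_one_sub_log hs hs1
  have h4 : K * s ^ 2 ≤ |K| * (s ^ 2 * (1 - log s)) := by
    have h5 : s ^ 2 ≤ s ^ 2 * (1 - log s) := by nlinarith [sq_nonneg s]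
    exact mul_le_mul (le_abs_self K) h5 (sq_nonneg s) (abs_nonneg K)
  have h6 : D * (|ρ - R| + |x - x₀|) ≤ D * (2 * (|K| * (s ^ 2 * (1 - log s)))) := by
    gcongr
    linarith
  have h7 := abs_sub_le (∑' m, cothTerm f ρ s x m) (∑' m, limTerm f ρ x m)
    (∑' m, limTerm f R x₀ m)
  linarith

theorem exists_abs_cschDiffSum_sub_invDiffSum_le {x₀ K : ℝ} (hx₀ : 0 < x₀) :
    ∃ C ≥ 0, ∀ s x : ℝ, 0 < s → s ≤ 1 → x₀ / 2 ≤ x → x ≤ 1 → |x - x₀| ≤ K * s ^ 2 →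
      |cschDiffSum s x - invDiffSum x₀| ≤ C * (s ^ 2 * (1 - log s)) := by
  have hZ : 0 ≤ ∑' m : ℕ, 1 / ((m : ℝ) + x₀ / 2) ^ 2 := tsum_nonneg fun m => by positivity
  refine ⟨34 + |K| * ∑' m : ℕ, 1 / ((m : ℝ) + x₀ / 2) ^ 2, by positivity,
    fun s x hs hs1 hx hx1 hK => ?_⟩
  have h1 := abs_cschDiffSum_sub_le hs hs1 (by linarith : 0 < x) hx1
  have h2 := abs_invDiffSum_sub_le (x₀ := x₀ / 2) (by linarith) hx (by linarith : x₀ / 2 ≤ x₀)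
  have h3 := one_le_one_sub_log hs hs1
  have h4 : K * s ^ 2 ≤ |K| * (s ^ 2 * (1 - log s)) := by
    have h5 : s ^ 2 ≤ s ^ 2 * (1 - log s) := by nlinarith [sq_nonneg s]
    exact mul_le_mul (le_abs_self K) h5 (sq_nonneg s) (abs_nonneg K)
  have h5 := mul_le_mul_of_nonneg_right (hK.trans h4) hZ
  have h6 : s ^ 2 * (34 - 16 * log s) ≤ 34 * (s ^ 2 * (1 - log s)) := by
    nlinarith [sq_nonneg s]
  have h7 := abs_sub_le (cschDiffSum s x) (invDiffSum x) (invDiffSum x₀)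
  linarith

theorem abs_weightedMean_sub_le {A₁ A₂ M₁ M₂ S₁ S₂ T₁ T₂ d e : ℝ} (hA₁ : 0 < A₁) (hA₂ : 0 < A₂)
    (hM₁ : 0 < M₁) (hM₂ : 0 < M₂) (h₁ : |A₁ - M₁| ≤ d) (h₂ : |A₂ - M₂| ≤ d)
    (h₃ : |S₁ - T₁| ≤ e) (h₄ : |S₂ - T₂| ≤ e) :
    |(A₁ * S₁ + A₂ * S₂) / (A₁ + A₂) - (M₁ * T₁ + M₂ * T₂) / (M₁ + M₂)| ≤
      e + |T₁ - T₂| * d / (M₁ + M₂) := by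
  have hA : 0 < A₁ + A₂ := add_pos hA₁ hA₂
  have hM : 0 < M₁ + M₂ := add_pos hM₁ hM₂
  have split : (A₁ * S₁ + A₂ * S₂) / (A₁ + A₂) - (M₁ * T₁ + M₂ * T₂) / (M₁ + M₂) =
      (A₁ * (S₁ - T₁) + A₂ * (S₂ - T₂)) / (A₁ + A₂) +
        (T₁ - T₂) * ((A₁ * (M₂ - A₂) + A₂ * (A₁ - M₁)) / ((A₁ + A₂) * (M₁ + M₂))) := by
    field_simp
    ring
  have bound : ∀ p q c : ℝ, |p| ≤ c → |q| ≤ c → |A₁ * p + A₂ * q| ≤ c * (A₁ + A₂) := by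
    intro p q c hp hq
    refine (abs_add_le _ _).trans ?_
    rw [abs_mul, abs_mul, abs_of_pos hA₁, abs_of_pos hA₂]
    nlinarith
  have b₁ : |(A₁ * (S₁ - T₁) + A₂ * (S₂ - T₂)) / (A₁ + A₂)| ≤ e := by
    rw [abs_div, abs_of_pos hA, div_le_iff₀ hA]
    exact bound _ _ _ h₃ h₄
  have b₂ : |(A₁ * (M₂ - A₂) + A₂ * (A₁ - M₁)) / ((A₁ + A₂) * (M₁ + M₂))| ≤ d / (M₁ + M₂) := by
    rw [abs_div, abs_of_pos (mul_pos hA hM), div_le_div_iff₀ (mul_pos hA hM) hM]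
    have := bound _ _ _ (by rwa [abs_sub_comm]) h₁
    nlinarith [mul_le_mul_of_nonneg_right this hM.le]
  rw [split, mul_div_assoc]
  refine (abs_add_le _ _).trans (add_le_add b₁ ?_)
  rw [abs_mul]
  gcongr

/-! ### Concentration factors as weighted means -/

theorem hasSum_exp_odd {v : ℝ} (hv : 0 < v) :
    HasSum (fun n : ℕ => exp (-((2 * n + 1) * v))) (1 / 2 * (1 / sinh v)) := by
  have h := (hasSum_geometric_of_lt_one (exp_pos (-(2 * v))).le
    (exp_lt_one_iff.2 (by linarith))).mul_left (exp (-v))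
  have e : exp (-v) * (1 - exp (-(2 * v)))⁻¹ = 1 / 2 * (1 / sinh v) := by
    have h1 : 0 < 1 - exp (-(2 * v)) := sub_pos.2 (exp_lt_one_iff.2 (by linarith))
    have h2 : 0 < exp v - exp (-v) := sub_pos.2 (exp_lt_exp.2 (by linarith))
    have h3 : exp (-v) * exp v = 1 := by rw [← exp_add]; simp
    have h4 : exp (-(2 * v)) = exp (-v) * exp (-v) := by rw [← exp_add]; ring_nf
    rw [h4] at h1 ⊢
    rw [sinh_eq, one_div_div, ← div_eq_mul_inv, one_div_mul_eq_div,
      div_div_cancel_left' two_ne_zero, inv_eq_one_div, div_eq_div_iff h1.ne' h2.ne']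
    linear_combination h3
  rw [e] at h
  refine h.congr_fun fun n => ?_
  rw [← exp_nat_mul, ← exp_add]
  ring_nf

theorem hasSum_exp_shift {s x c : ℝ} (hc : 0 < c) (hs : 0 < s) :
    HasSum (fun k : ℕ => exp (-(c * (s * (k + x)))))
      (exp (c * (s * (1 - x))) / (exp (c * s) - 1)) := by
  have hcs : 0 < c * s := mul_pos hc hs
  have h := (hasSum_geometric_of_lt_one (exp_pos (-(c * s))).le
    (exp_lt_one_iff.2 (by linarith))).mul_left (exp (-(c * (s * x))))
  have e : exp (-(c * (s * x))) * (1 - exp (-(c * s)))⁻¹ =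
      exp (c * (s * (1 - x))) / (exp (c * s) - 1) := by
    have h1 : 0 < 1 - exp (-(c * s)) := sub_pos.2 (exp_lt_one_iff.2 (by linarith))
    have h2 : 0 < exp (c * s) - 1 := sub_pos.2 (one_lt_exp_iff.2 hcs)
    have h3 : exp (c * (s * (1 - x))) = exp (-(c * (s * x))) * exp (c * s) := by
      rw [← exp_add]
      ring_nf
    have h4 : exp (-(c * s)) * exp (c * s) = 1 := by rw [← exp_add]; simp
    rw [h3, ← div_eq_mul_inv, div_eq_div_iff h1.ne' h2.ne']
    linear_combination exp (-(c * (s * x))) * h4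
  rw [e] at h
  refine h.congr_fun fun k => ?_
  rw [← exp_nat_mul, ← exp_add]
  ring_nf

theorem U_eq {s x : ℝ} (hs : 0 < s) (hx : 0 < x) :
    U s (s * (1 - x)) = 1 / 2 * ∑' k : ℕ, 1 / sinh (s * (k + x)) := by
  have hk : ∀ k : ℕ, HasSum (fun n : ℕ => exp (-((2 * n + 1) * (s * (k + x)))))
      (1 / 2 * (1 / sinh (s * (k + x)))) := fun k => hasSum_exp_odd (by positivity)
  have hn : ∀ n : ℕ, HasSum (fun k : ℕ => exp (-((2 * n + 1) * (s * (k + x)))))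
      (exp ((2 * n + 1) * (s * (1 - x))) / (exp ((2 * n + 1) * s) - 1)) := fun n =>
    hasSum_exp_shift (by positivity) hs
  have hprod : Summable (Function.uncurry fun (k n : ℕ) =>
      exp (-((2 * (n : ℝ) + 1) * (s * (k + x))))) := by
    refine (summable_prod_of_nonneg fun p => (exp_pos _).le).2 ⟨fun k => (hk k).summable, ?_⟩
    refine ((summable_inv_sinh hs hx).mul_left (1 / 2)).congr fun k => ?_
    exact (hk k).tsum_eq.symm
  rw [U, ← tsum_mul_left]
  calc _ = ∑' (n : ℕ) (k : ℕ), exp (-((2 * (n : ℝ) + 1) * (s * (k + x)))) :=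
        tsum_congr fun n => (hn n).tsum_eq.symm
    _ = ∑' (k : ℕ) (n : ℕ), exp (-((2 * (n : ℝ) + 1) * (s * (k + x)))) := hprod.tsum_comm
    _ = _ := tsum_congr fun k => (hk k).tsum_eq

theorem U_sub_U_zero {s x : ℝ} (hs : 0 < s) (hx : 0 < x) :
    U s (s * (1 - x)) - U s 0 = cschDiffSum s x / (2 * s) := by
  have h0 := U_eq hs one_pos
  rw [sub_self, mul_zero] at h0
  rw [U_eq hs hx, h0, ← mul_sub,
    ← (summable_inv_sinh hs hx).tsum_sub (summable_inv_sinh hs one_pos),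
    eq_div_iff (by positivity), cschDiffSum, ← tsum_mul_left, ← tsum_mul_right]
  refine tsum_congr fun m => ?_
  ring

theorem U_zero_pos {s : ℝ} (hs : 0 < s) : 0 < U s 0 := by
  have h0 := U_eq hs one_pos
  rw [sub_self, mul_zero] at h0
  rw [h0]
  have h : ∀ m : ℕ, 0 < 1 / sinh (s * (m + 1)) := fun m =>
    one_div_pos.2 (sinh_pos_iff.2 (by positivity))
  exact mul_pos (by norm_num)
    ((summable_inv_sinh hs one_pos).tsum_pos (fun m => (h m).le) 0 (h 0))

theorem tsum_cothTerm_sub {f g : ℝ → ℝ} {β β' ρ s x y : ℝ} (hf : HasQuadraticRemainder f β)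
    (hg : HasQuadraticRemainder g β') (hs : 0 < s) (hρ : 0 < ρ) (hx : 0 < x) (hy : 0 < y) :
    ∑' m : ℕ, (4 * π * (ρ * s) / sinh (s * (m + x)) * f (ρ * s * coth (s * (m + x))) -
      4 * π * (ρ * s) / sinh (s * (m + y)) * g (ρ * s * coth (s * (m + y)))) =
      4 * π * (∑' m, cothTerm f ρ s x m - ∑' m, cothTerm g ρ s y m) := by
  rw [← (summable_cothTerm hf hs hx hρ).tsum_sub (summable_cothTerm hg hs hy hρ), ← tsum_mul_left]
  refine tsum_congr fun m => ?_
  rw [cothTerm, cothTerm]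
  ring

theorem CHeps_eq {f : ℝ → ℝ} {β r₁ r₂ ε ρ s x : ℝ} (hf : HasQuadraticRemainder f β) (hs : 0 < s)
    (hρ : 0 < ρ) (hx : 0 < x) (hx1 : x < 1) (ha : aEps r₁ r₂ ε = ρ * s)
    (hξ₁ : xi r₁ r₁ r₂ ε = s * x) (hξ₂ : xi r₂ r₁ r₂ ε = s * (1 - x)) :
    Cconst r₁ r₂ ε 1 ≠ Cconst r₁ r₂ ε 2 ∧ CHeps f r₁ r₂ ε =
      (cschDiffSum s (1 - x) * (4 * π * (∑' m, cothTerm f ρ s 1 m -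
          ∑' m, cothTerm (fun t => f (-t)) ρ s x m)) +
        cschDiffSum s x * (4 * π * (∑' m, cothTerm f ρ s (1 - x) m -
          ∑' m, cothTerm (fun t => f (-t)) ρ s 1 m))) /
      (cschDiffSum s (1 - x) + cschDiffSum s x) := by
  have hx' : 0 < 1 - x := by linarith
  have hs0 : sZero r₁ r₂ ε = s := by rw [sZero, hξ₁, hξ₂]; ring
  have hA₁ := cschDiffSum_pos hs hx' (by linarith)
  have hA₂ := cschDiffSum_pos hs hx hx1
  have hU₁ := U_sub_U_zero hs hx'
  have hU₂ := U_sub_U_zero hs hx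
  rw [sub_sub_cancel] at hU₁
  have hU₀ := U_zero_pos hs
  have hU₁' : 0 < cschDiffSum s (1 - x) / (2 * s) := by positivity
  have hU₂' : 0 < cschDiffSum s x / (2 * s) := by positivity
  set D := U s (s * x) * U s (s * (1 - x)) - U s 0 ^ 2 with hD
  have hD0 : 0 < D := by nlinarith
  set κ := 1 / (8 * π * (ρ * s) * D * (2 * s)) with hκ
  have hκ0 : 0 < κ := by positivity
  have hC₁ : Cconst r₁ r₂ ε 1 = -(κ * cschDiffSum s (1 - x)) := by
    rw [Cconst, hs0, ha, hξ₁, hξ₂, if_pos rfl, hξ₁, hU₁, hκ, ← hD]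
    field_simp
  have hC₂ : Cconst r₁ r₂ ε 2 = κ * cschDiffSum s x := by
    rw [Cconst, hs0, ha, hξ₁, hξ₂, if_neg (by norm_num), hξ₂, hU₂, hκ, ← hD]
    field_simp
  have hm1 : ∀ m : ℕ, (m : ℝ) * s + s = s * (m + 1) := fun m => by ring
  have hmx : ∀ m : ℕ, ∀ y : ℝ, (m : ℝ) * s + s * y = s * (m + y) := fun m y => by ring
  have hS₁ := tsum_cothTerm_sub hf hf.comp_neg hs hρ one_pos hx
  have hS₂ := tsum_cothTerm_sub hf hf.comp_neg hs hρ hx' one_pos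
  constructor
  · rw [hC₁, hC₂]
    have := mul_pos hκ0 hA₁
    have := mul_pos hκ0 hA₂
    linarith
  · simp only [CHeps, qM, xiM, hs0, ha, hξ₁, hξ₂, hm1, hmx]
    have e : -(κ * cschDiffSum s (1 - x)) - κ * cschDiffSum s x =
        -(κ * (cschDiffSum s (1 - x) + cschDiffSum s x)) := by ring
    have hA := add_pos hA₁ hA₂
    rw [hS₁, hS₂, hC₁, hC₂, e, div_eq_div_iff (neg_ne_zero.2 (mul_pos hκ0 hA).ne') hA.ne']
    ring

theorem digammaVal_add_eulerMascheroniConstant {z : ℝ} (hz : 0 < z) :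
    digammaVal z + eulerMascheroniConstant = -invDiffSum z := by
  rw [digammaVal, invDiffSum, ← tsum_neg, neg_add_cancel_comm]
  refine tsum_congr fun m => ?_
  field_simp
  ring

theorem CH_eq {f : ℝ → ℝ} {β r₁ r₂ : ℝ} (hf : HasQuadraticRemainder f β) (hr₁ : 0 < r₁)
    (hr₂ : 0 < r₂) : CH f r₁ r₂ =
      (invDiffSum (r₁ / (r₁ + r₂)) * (4 * π * (∑' m, limTerm f (rTilde r₁ r₂) 1 m -
          ∑' m, limTerm (fun t => f (-t)) (rTilde r₁ r₂) (r₂ / (r₁ + r₂)) m)) +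
        invDiffSum (r₂ / (r₁ + r₂)) * (4 * π *
          (∑' m, limTerm f (rTilde r₁ r₂) (r₁ / (r₁ + r₂)) m -
          ∑' m, limTerm (fun t => f (-t)) (rTilde r₁ r₂) 1 m))) /
      (invDiffSum (r₁ / (r₁ + r₂)) + invDiffSum (r₂ / (r₁ + r₂))) := by
  have hR : 0 < rTilde r₁ r₂ := by rw [rTilde]; positivity
  have hz₁ : 0 < r₁ / (r₁ + r₂) := by positivity
  have hz₂ : 0 < r₂ / (r₁ + r₂) := by positivity
  have h₁ := digammaVal_add_eulerMascheroniConstant hz₁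
  have h₂ := digammaVal_add_eulerMascheroniConstant hz₂
  have h₃ : digammaVal (r₁ / (r₁ + r₂)) + digammaVal (r₂ / (r₁ + r₂)) +
      2 * eulerMascheroniConstant =
      -(invDiffSum (r₁ / (r₁ + r₂)) + invDiffSum (r₂ / (r₁ + r₂))) := by
    linear_combination h₁ + h₂
  rw [← (summable_limTerm hf one_pos hR).tsum_sub (summable_limTerm hf.comp_neg hz₂ hR),
    ← (summable_limTerm hf hz₁ hR).tsum_sub (summable_limTerm hf.comp_neg one_pos hR), CH,
    muConst, muConst, if_pos rfl, if_neg (by norm_num), h₁, h₂, h₃, neg_div_neg_eq, neg_div_neg_eq]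
  simp only [limTerm]
  ring

/-! ### Asymptotics of the geometric parameters -/

theorem arsinh_le_self {t : ℝ} (ht : 0 ≤ t) : arsinh t ≤ t := by
  have h := self_le_sinh_iff.2 (arsinh_nonneg_iff.2 ht)
  rwa [sinh_arsinh] at h

theorem sub_arsinh_le {t : ℝ} (ht : 0 ≤ t) : t - arsinh t ≤ t ^ 3 / 2 := by
  have h0 := arsinh_nonneg_iff.2 ht
  have h := sinh_sub_self_le h0
  rw [sinh_arsinh] at h
  have h2 : arsinh t ^ 2 ≤ t ^ 2 := by
    have := arsinh_le_self ht
    gcongr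
  nlinarith

/-- Quantitative closeness of `arsinh` to the identity, for the normalised sum and quotient. -/
theorem arsinh_ratio_bounds {a p q κ : ℝ} (ha : 0 < a) (hp : 0 < p) (hq : 0 < q)
    (hκ : κ = ((p ^ 3 + q ^ 3) / 2)) (hsmall : κ * a ^ 2 ≤ (p + q) / 2) :
    a * (p + q) / 2 ≤ arsinh (a * p) + arsinh (a * q) ∧
    arsinh (a * p) + arsinh (a * q) ≤ a * (p + q) ∧
    |a / (arsinh (a * p) + arsinh (a * q)) - 1 / (p + q)| ≤ 2 * κ / (p + q) ^ 2 * a ^ 2 ∧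
    |arsinh (a * p) / (arsinh (a * p) + arsinh (a * q)) - p / (p + q)| ≤
      4 * κ / (p + q) * a ^ 2 := by
  have hap : 0 < a * p := mul_pos ha hp
  have haq : 0 < a * q := mul_pos ha hq
  have hκ0 : 0 < κ := by rw [hκ]; positivity
  have p1 := arsinh_le_self hap.le
  have p2 := sub_arsinh_le hap.le
  have q1 := arsinh_le_self haq.le
  have q2 := sub_arsinh_le haq.le
  set X := arsinh (a * p)
  set Y := arsinh (a * q)
  have hκa : κ * a ^ 3 = (a * p) ^ 3 / 2 + (a * q) ^ 3 / 2 := by rw [hκ]; ring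
  have hsm : κ * a ^ 3 ≤ a * (p + q) / 2 := by nlinarith
  have hP : 0 < p + q := add_pos hp hq
  have hlow : a * (p + q) / 2 ≤ X + Y := by nlinarith
  have hs : 0 < X + Y := lt_of_lt_of_le (by positivity) hlow
  have hup : X + Y ≤ a * (p + q) := by linarith
  refine ⟨hlow, hup, ?_, ?_⟩
  · have e : a / (X + Y) - 1 / (p + q) = (a * (p + q) - (X + Y)) / ((X + Y) * (p + q)) := by
      field_simp
    have e2 : 2 * κ / (p + q) ^ 2 * a ^ 2 = κ * a ^ 3 / (a * (p + q) / 2 * (p + q)) := by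
      field_simp
    rw [e, abs_div, abs_of_nonneg (sub_nonneg.2 hup), abs_of_pos (mul_pos hs hP), e2]
    gcongr
    linarith
  · have e : X / (X + Y) - p / (p + q) =
        (p * (a * (p + q) - (X + Y)) - (p + q) * (a * p - X)) / ((X + Y) * (p + q)) := by
      field_simp
      ring
    have e2 : 4 * κ / (p + q) * a ^ 2 =
        2 * (p + q) * (κ * a ^ 3) / (a * (p + q) / 2 * (p + q)) := by
      field_simp
      ring
    have b1 : 0 ≤ (a * p) ^ 3 := by positivity
    have b2 : 0 ≤ (a * q) ^ 3 := by positivity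
    rw [e, abs_div, abs_of_pos (mul_pos hs hP), e2]
    gcongr
    have c1 : p * (a * (p + q) - (X + Y)) ≤ (p + q) * (κ * a ^ 3) :=
      mul_le_mul (by linarith) (by linarith) (by linarith) hP.le
    have c2 : (p + q) * (a * p - X) ≤ (p + q) * (κ * a ^ 3) :=
      mul_le_mul_of_nonneg_left (by linarith) hP.le
    have c3 : 0 ≤ p * (a * (p + q) - (X + Y)) := mul_nonneg hp.le (by linarith)
    have c4 : 0 ≤ (p + q) * (a * p - X) := mul_nonneg hP.le (by linarith)
    rw [abs_le]
    constructor <;> linarith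

theorem aEps_pos {r₁ r₂ ε : ℝ} (hr₁ : 0 < r₁) (hr₂ : 0 < r₂) (hε : 0 < ε) :
    0 < aEps r₁ r₂ ε := by
  rw [aEps]
  positivity

theorem exists_aEps_sq_bounds {r₁ r₂ : ℝ} (hr₁ : 0 < r₁) (hr₂ : 0 < r₂) :
    ∃ c > 0, ∃ A > 0, ∀ ε : ℝ, 0 < ε → ε ≤ 1 →
      c * ε ≤ aEps r₁ r₂ ε ^ 2 ∧ aEps r₁ r₂ ε ^ 2 ≤ A * ε := by
  refine ⟨(2 * r₁) * (2 * r₂) * (2 * r₁ + 2 * r₂) / (2 * (r₁ + r₂ + 1)) ^ 2, by positivity,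
    (2 * r₁ + 1) * (2 * r₂ + 1) * (2 * r₁ + 2 * r₂ + 1) / (2 * (r₁ + r₂)) ^ 2, by positivity,
    fun ε hε hε1 => ?_⟩
  have e : aEps r₁ r₂ ε ^ 2 =
      (2 * r₁ + ε) * (2 * r₂ + ε) * (2 * r₁ + 2 * r₂ + ε) / (2 * (r₁ + r₂ + ε)) ^ 2 * ε := by
    rw [aEps, div_pow, mul_pow, sq_sqrt hε.le, sq_sqrt (by positivity)]
    ring
  rw [e]
  have h₁ : 2 * r₁ ≤ 2 * r₁ + ε := by linarith
  have h₂ : 2 * r₂ ≤ 2 * r₂ + ε := by linarith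
  have h₃ : 2 * r₁ + 2 * r₂ ≤ 2 * r₁ + 2 * r₂ + ε := by linarith
  constructor
  · refine mul_le_mul_of_nonneg_right (div_le_div₀ (by positivity) ?_ (by positivity) ?_) hε.le
    · exact mul_le_mul (mul_le_mul h₁ h₂ (by positivity) (by positivity)) h₃ (by positivity)
        (by positivity)
    · exact pow_le_pow_left₀ (by positivity) (by linarith) 2
  · refine mul_le_mul_of_nonneg_right (div_le_div₀ (by positivity) ?_ (by positivity) ?_) hε.le
    · gcongr
    · exact pow_le_pow_left₀ (by positivity) (by linarith) 2

open Filter Topology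

theorem eventually_mul_le {B η : ℝ} (hη : 0 < η) : ∀ᶠ ε in 𝓝[>] (0 : ℝ), B * ε ≤ η := by
  have h : Tendsto (fun ε : ℝ => B * ε) (𝓝[>] 0) (𝓝 (B * 0)) :=
    (continuous_const.mul continuous_id).continuousAt.continuousWithinAt
  rw [mul_zero] at h
  exact h.eventually (ge_mem_nhds hη)

/-- For small `ε` the geometry is governed by `s = s₀`, `ρ = a_ε / s₀` and `x = ξ₁ / s₀`. -/
theorem exists_eventually_parameter_bounds {r₁ r₂ : ℝ} (hr₁ : 0 < r₁) (hr₂ : 0 < r₂) :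
    ∃ K > 0, ∀ᶠ ε in 𝓝[>] (0 : ℝ), ∃ ρ s x : ℝ, 0 < ρ ∧ 0 < s ∧ aEps r₁ r₂ ε = ρ * s ∧
      xi r₁ r₁ r₂ ε = s * x ∧ xi r₂ r₁ r₂ ε = s * (1 - x) ∧ ε ≤ s ∧ s ≤ 1 ∧ s ^ 2 ≤ K * ε ∧
      ρ ≤ 2 * rTilde r₁ r₂ ∧ |ρ - rTilde r₁ r₂| ≤ K * s ^ 2 ∧ |x - r₂ / (r₁ + r₂)| ≤ K * s ^ 2 ∧
      r₂ / (r₁ + r₂) / 2 ≤ x ∧ r₁ / (r₁ + r₂) / 2 ≤ 1 - x := by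
  obtain ⟨c, hc, A, hA, haε⟩ := exists_aEps_sq_bounds hr₁ hr₂
  have hp : 0 < 1 / r₁ := by positivity
  have hq : 0 < 1 / r₂ := by positivity
  obtain ⟨P, hP⟩ : ∃ P, P = 1 / r₁ + 1 / r₂ := ⟨_, rfl⟩
  obtain ⟨κ, hκ⟩ : ∃ κ, κ = ((1 / r₁) ^ 3 + (1 / r₂) ^ 3) / 2 := ⟨_, rfl⟩
  have hP0 : 0 < P := by rw [hP]; positivity
  have hκ0 : 0 < κ := by rw [hκ]; positivity
  have hRP : 1 / P = rTilde r₁ r₂ := by rw [hP, rTilde]; field_simp; ring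
  have hxP : 1 / r₁ / P = r₂ / (r₁ + r₂) := by rw [hP]; field_simp; ring
  have hx₁ : 0 < r₁ / (r₁ + r₂) := by positivity
  have hx₂ : 0 < r₂ / (r₁ + r₂) := by positivity
  have hx₁₂ : r₁ / (r₁ + r₂) + r₂ / (r₁ + r₂) = 1 := by field_simp
  have hK₁ : 0 < 8 * κ / P ^ 4 := by positivity
  have hK₂ : 0 < 16 * κ / P ^ 3 := by positivity
  have hK₃ : 0 < P ^ 2 * A := by positivity
  refine ⟨P ^ 2 * A + 8 * κ / P ^ 4 + 16 * κ / P ^ 3, by positivity, ?_⟩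
  filter_upwards [self_mem_nhdsWithin, eventually_mul_le (B := 1) one_pos,
    eventually_mul_le (B := κ * A) (half_pos hP0), eventually_mul_le (B := P ^ 2 * A) one_pos,
    eventually_mul_le (B := 4 * κ / P * A) (half_pos hx₁),
    eventually_mul_le (B := 4 * κ / P * A) (half_pos hx₂),
    eventually_mul_le (B := 4) (η := c * P ^ 2) (by positivity)] with ε hε e₁ e₂ e₃ e₄ e₅ e₆
  replace hε : 0 < ε := hε
  rw [one_mul] at e₁
  obtain ⟨ha₁, ha₂⟩ := haε ε hε e₁
  have ha := aEps_pos hr₁ hr₂ hε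
  have hξ₁ : xi r₁ r₁ r₂ ε = arsinh (aEps r₁ r₂ ε * (1 / r₁)) := by rw [xi, mul_one_div]
  have hξ₂ : xi r₂ r₁ r₂ ε = arsinh (aEps r₁ r₂ ε * (1 / r₂)) := by rw [xi, mul_one_div]
  set a := aEps r₁ r₂ ε
  have hmono : ∀ t : ℝ, 0 ≤ t → t * a ^ 2 ≤ t * A * ε := fun t ht => by
    rw [mul_assoc]
    exact mul_le_mul_of_nonneg_left ha₂ ht
  have hsmall : κ * a ^ 2 ≤ P / 2 := (hmono κ hκ0.le).trans e₂
  rw [hP] at hsmall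
  obtain ⟨b₁, b₂, b₃, b₄⟩ := arsinh_ratio_bounds ha hp hq hκ hsmall
  rw [← hξ₁, ← hξ₂, ← hP] at b₁ b₂ b₃ b₄
  rw [hRP] at b₃
  rw [hxP] at b₄
  set s := xi r₁ r₁ r₂ ε + xi r₂ r₁ r₂ ε with hsdef
  have haP : 0 < a * P := mul_pos ha hP0
  have hs : 0 < s := lt_of_lt_of_le (by positivity) b₁
  have hs2 : s ^ 2 ≤ P ^ 2 * A * ε :=
    (pow_le_pow_left₀ hs.le b₂ 2).trans ((by ring : (a * P) ^ 2 = P ^ 2 * a ^ 2).trans_le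
      (hmono _ (by positivity)))
  have has : a ^ 2 ≤ 4 / P ^ 2 * s ^ 2 := by
    have := pow_le_pow_left₀ (by positivity) b₁ 2
    rw [div_mul_eq_mul_div, le_div_iff₀ (by positivity)]
    linarith [mul_pow a P 2, div_pow (a * P) 2 2]
  have hs1 : s ≤ 1 := (sq_le_one_iff₀ hs.le).1 (hs2.trans e₃)
  have b₄' : 4 * κ / P * a ^ 2 ≤ 4 * κ / P * A * ε := hmono _ (by positivity)
  have b₅ := abs_le.1 b₄
  have hεs : ε ≤ s := by
    have h1 : 4 / P ^ 2 * s ^ 2 * P ^ 2 = 4 * s ^ 2 := by field_simp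
    have h2 := mul_le_mul_of_nonneg_right (ha₁.trans has) (by positivity : 0 ≤ P ^ 2)
    have h3 := mul_le_mul_of_nonneg_right e₆ hε.le
    have h4 : ε ^ 2 ≤ s ^ 2 := by linarith
    exact (sq_le_sq₀ hε.le hs.le).1 h4
  refine ⟨a / s, s, xi r₁ r₁ r₂ ε / s, div_pos ha hs, hs, (div_mul_cancel₀ a hs.ne').symm,
    (mul_div_cancel₀ _ hs.ne').symm, ?_, hεs, hs1, ?_, ?_, ?_, ?_, by linarith, by linarith⟩
  · rw [mul_sub, mul_div_cancel₀ _ hs.ne']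
    linarith
  · exact hs2.trans (mul_le_mul_of_nonneg_right (by linarith) hε.le)
  · rw [← hRP, div_le_iff₀ hs, mul_one_div, div_mul_eq_mul_div, le_div_iff₀ hP0]
    linarith
  · have h : 2 * κ / P ^ 2 * a ^ 2 ≤ 8 * κ / P ^ 4 * s ^ 2 :=
      (mul_le_mul_of_nonneg_left has (by positivity)).trans_eq (by field_simp; ring)
    exact b₃.trans (h.trans (mul_le_mul_of_nonneg_right (by linarith) (sq_nonneg s)))
  · have h : 4 * κ / P * a ^ 2 ≤ 16 * κ / P ^ 3 * s ^ 2 :=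
      (mul_le_mul_of_nonneg_left has (by positivity)).trans_eq (by field_simp; ring)
    exact b₄.trans (h.trans (mul_le_mul_of_nonneg_right (by linarith) (sq_nonneg s)))

theorem exists_abs_four_pi_mul_sub_le {f g : ℝ → ℝ} {β β' x₀ y₀ R K : ℝ}
    (hf : HasQuadraticRemainder f β) (hg : HasQuadraticRemainder g β') (hx₀ : 0 < x₀)
    (hy₀ : 0 < y₀) (hR : 0 < R) :
    ∃ C ≥ 0, ∀ s x y ρ : ℝ, 0 < s → s ≤ 1 → x₀ / 2 ≤ x → x ≤ 1 → y₀ / 2 ≤ y → y ≤ 1 → 0 < ρ →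
      ρ ≤ 2 * R → |ρ - R| ≤ K * s ^ 2 → |x - x₀| ≤ K * s ^ 2 → |y - y₀| ≤ K * s ^ 2 →
      |4 * π * (∑' m, cothTerm f ρ s x m - ∑' m, cothTerm g ρ s y m) -
        4 * π * (∑' m, limTerm f R x₀ m - ∑' m, limTerm g R y₀ m)| ≤
        C * (s ^ 2 * (1 - log s)) := by
  obtain ⟨C, hC, h⟩ := exists_abs_tsum_cothTerm_sub_limTerm_le (K := K) hf hx₀ hR
  obtain ⟨D, hD, h'⟩ := exists_abs_tsum_cothTerm_sub_limTerm_le (K := K) hg hy₀ hR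
  refine ⟨4 * π * (C + D), by positivity, ?_⟩
  intro s x y ρ hs hs1 hx hx1 hy hy1 hρ hρR hK hKx hKy
  rw [← mul_sub, abs_mul, abs_of_pos (by positivity : 0 < 4 * π), mul_assoc (4 * π)]
  refine mul_le_mul_of_nonneg_left ?_ (by positivity)
  rw [sub_sub_sub_comm, add_mul]
  exact (abs_sub _ _).trans (add_le_add (h s x ρ hs hs1 hx hx1 hρ hρR hK hKx)
    (h' s y ρ hs hs1 hy hy1 hρ hρR hK hKy))

theorem sq_mul_one_sub_log_le {ε s K : ℝ} (hε : 0 < ε) (hε1 : ε ≤ exp (-1)) (hεs : ε ≤ s)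
    (hs1 : s ≤ 1) (hK : s ^ 2 ≤ K * ε) : s ^ 2 * (1 - log s) ≤ 2 * K * (ε * |log ε|) := by
  have h1 : log ε ≤ -1 := (log_le_iff_le_exp hε).2 hε1
  have h2 : log ε ≤ log s := log_le_log hε hεs
  have h3 := one_le_one_sub_log (hε.trans_le hεs) hs1
  rw [abs_of_nonpos (by linarith)]
  calc s ^ 2 * (1 - log s) ≤ K * ε * (2 * -log ε) :=
        mul_le_mul hK (by linarith) (by linarith) ((sq_nonneg s).trans hK)
    _ = 2 * K * (ε * -log ε) := by ring

theorem exists_eventually_abs_CHeps_sub_CH_le {f : ℝ → ℝ} {β r₁ r₂ : ℝ}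
    (hf : HasQuadraticRemainder f β) (hr₁ : 0 < r₁) (hr₂ : 0 < r₂) :
    ∃ C > 0, ∀ᶠ ε in 𝓝[>] (0 : ℝ), Cconst r₁ r₂ ε 1 ≠ Cconst r₁ r₂ ε 2 ∧
      |CHeps f r₁ r₂ ε - CH f r₁ r₂| ≤ C * ε * |log ε| := by
  obtain ⟨K, hK, hpar⟩ := exists_eventually_parameter_bounds hr₁ hr₂
  have hR : 0 < rTilde r₁ r₂ := by rw [rTilde]; positivity
  have hx₁ : 0 < r₁ / (r₁ + r₂) := by positivity
  have hx₂ : 0 < r₂ / (r₁ + r₂) := by positivity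
  have hx₁₂ : r₁ / (r₁ + r₂) + r₂ / (r₁ + r₂) = 1 := by field_simp
  obtain ⟨E₁, hE₁, hS₁⟩ := exists_abs_four_pi_mul_sub_le (K := K) hf hf.comp_neg one_pos hx₂ hR
  obtain ⟨E₂, hE₂, hS₂⟩ := exists_abs_four_pi_mul_sub_le (K := K) hf hf.comp_neg hx₁ one_pos hR
  obtain ⟨D₁, hD₁, hA₁⟩ := exists_abs_cschDiffSum_sub_invDiffSum_le (K := K) hx₁
  obtain ⟨D₂, hD₂, hA₂⟩ := exists_abs_cschDiffSum_sub_invDiffSum_le (K := K) hx₂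
  have hM₁ := invDiffSum_pos hx₁ (by linarith)
  have hM₂ := invDiffSum_pos hx₂ (by linarith)
  rw [CH_eq hf hr₁ hr₂]
  set T₁ := 4 * π * (∑' m, limTerm f (rTilde r₁ r₂) 1 m -
    ∑' m, limTerm (fun t => f (-t)) (rTilde r₁ r₂) (r₂ / (r₁ + r₂)) m)
  set T₂ := 4 * π * (∑' m, limTerm f (rTilde r₁ r₂) (r₁ / (r₁ + r₂)) m -
    ∑' m, limTerm (fun t => f (-t)) (rTilde r₁ r₂) 1 m)
  set M₁ := invDiffSum (r₁ / (r₁ + r₂))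
  set M₂ := invDiffSum (r₂ / (r₁ + r₂))
  obtain ⟨B, hB⟩ : ∃ B, B = (E₁ + E₂) + |T₁ - T₂| * (D₁ + D₂) / (M₁ + M₂) := ⟨_, rfl⟩
  have hB0 : 0 ≤ B := by rw [hB]; positivity
  refine ⟨B * (2 * K) + 1, by positivity, ?_⟩
  have hsmall : ∀ᶠ ε in 𝓝[>] (0 : ℝ), 1 * ε ≤ exp (-1) := eventually_mul_le (exp_pos _)
  filter_upwards [self_mem_nhdsWithin, hsmall, hpar] with ε hε hε1 h
  obtain ⟨ρ, s, x, hρ, hs, ha, hξ₁, hξ₂, hεs, hs1, hsK, hρR, hρK, hxK, hxl, hxu⟩ := h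
  replace hε : 0 < ε := hε
  rw [one_mul] at hε1
  obtain ⟨hne, hform⟩ := CHeps_eq hf hs hρ (by linarith) (by linarith) ha hξ₁ hξ₂
  refine ⟨hne, ?_⟩
  rw [hform]
  have hxK' : |1 - x - r₁ / (r₁ + r₂)| ≤ K * s ^ 2 := by
    rwa [show 1 - x - r₁ / (r₁ + r₂) = -(x - r₂ / (r₁ + r₂)) by linarith, abs_neg]
  have h11 : |(1 : ℝ) - 1| ≤ K * s ^ 2 := by
    rw [sub_self, abs_zero]
    positivity
  have hη0 : 0 ≤ s ^ 2 * (1 - log s) :=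
    mul_nonneg (sq_nonneg s) (zero_le_one.trans (one_le_one_sub_log hs hs1))
  have hη := sq_mul_one_sub_log_le hε hε1 hεs hs1 hsK
  have bS₁ := hS₁ s 1 x ρ hs hs1 (by norm_num) le_rfl hxl (by linarith) hρ hρR hρK h11 hxK
  have bS₂ := hS₂ s (1 - x) 1 ρ hs hs1 hxu (by linarith) (by norm_num) le_rfl hρ hρR hρK hxK' h11
  have bA₁ := hA₁ s (1 - x) hs hs1 hxu (by linarith) hxK'
  have bA₂ := hA₂ s x hs hs1 hxl (by linarith) hxK
  set η := s ^ 2 * (1 - log s)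
  have q₁ := mul_nonneg hE₁ hη0
  have q₂ := mul_nonneg hE₂ hη0
  have q₃ := mul_nonneg hD₁ hη0
  have q₄ := mul_nonneg hD₂ hη0
  have hmean := abs_weightedMean_sub_le (d := (D₁ + D₂) * η) (e := (E₁ + E₂) * η)
    (cschDiffSum_pos hs (by linarith : 0 < 1 - x) (by linarith))
    (cschDiffSum_pos hs (by linarith : 0 < x) (by linarith)) hM₁ hM₂
    (by linarith) (by linarith) (bS₁.trans (by linarith)) (bS₂.trans (by linarith))
  have hεl : 0 ≤ ε * |log ε| := by positivity
  calc _ ≤ (E₁ + E₂) * η + |T₁ - T₂| * ((D₁ + D₂) * η) / (M₁ + M₂) := hmean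
    _ = B * η := by rw [hB]; ring
    _ ≤ B * (2 * K * (ε * |log ε|)) := mul_le_mul_of_nonneg_left hη hB0
    _ ≤ (B * (2 * K) + 1) * ε * |log ε| := by linarith

theorem stmt7 (r₁ r₂ : ℝ) (hr₁ : 0 < r₁) (hr₂ : 0 < r₂)
    (f : ℝ → ℝ) (b : ℕ → ℝ) (hb0 : b 0 = 0)
    (hbsum : ∀ R > 0, Summable fun k : ℕ => |b k| * R ^ k)
    (hf : ∀ t : ℝ, f t = ∑' k : ℕ, b k * t ^ k) :
    ∃ C > 0, ∃ ε₀ > 0, ∀ ε ∈ Set.Ioo 0 ε₀,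
      Cconst r₁ r₂ ε 1 ≠ Cconst r₁ r₂ ε 2 ∧
      |CHeps f r₁ r₂ ε - CH f r₁ r₂| ≤ C * ε * |Real.log ε| := by
  obtain ⟨C, hC, h⟩ := exists_eventually_abs_CHeps_sub_CH_le
    (hasQuadraticRemainder_of_powerSeries hb0 hbsum hf) hr₁ hr₂
  obtain ⟨ε₀, hε₀, hsub⟩ := mem_nhdsGT_iff_exists_Ioo_subset.1 h
  exact ⟨C, hC, ε₀, hε₀, fun ε hε => hsub hε⟩

end
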